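/- arXiv:1001.3814 — 3 statements merged into one kernel-verified Lean document; each statement's English description precedes it below -/
import Mathlib

section
/- Let α > -1/2. There is a constant C > 0 such that for all s, y, z > 0 with y z e^{-s}/(1 - e^{-2s}) ≥ 1, |∂/∂s W_s^α(y,z)| ≤ C e^{-((z - e^{-s}y)² + (y - e^{-s}z)²)/(2(1 - e^{-2s}))} · e^{-3s/2} (1 - e^{-2s})^{-5/2} (y² + z²), where W_s^α is the Laguerre heat kernel. -/
open MeasureTheory Real

/-- The modified Bessel function of the first kind `I_a`. -/
noncomputable def besselI (a x : ℝ) : ℝ :=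
  ∑' k : ℕ, (x / 2) ^ (2 * (k : ℝ) + a) / ((Nat.factorial k : ℝ) * Real.Gamma ((k : ℝ) + a + 1))

/-- The Laguerre heat kernel `W_s^α(y,z)`. -/
noncomputable def laguerreHeatKernel (a s y z : ℝ) : ℝ :=
  (2 * Real.exp (-s) / (1 - Real.exp (-2 * s))) ^ ((1 : ℝ) / 2) *
    (2 * y * z * Real.exp (-s) / (1 - Real.exp (-2 * s))) ^ ((1 : ℝ) / 2) *
    besselI a (2 * y * z * Real.exp (-s) / (1 - Real.exp (-2 * s))) *
    Real.exp (-(1 / 2) * (y ^ 2 + z ^ 2) * (1 + Real.exp (-2 * s)) / (1 - Real.exp (-2 * s)))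

/-- The Hermite (Mehler) heat kernel `W_s(x,y)`. -/
noncomputable def hermiteHeatKernel (s x y : ℝ) : ℝ :=
  Real.pi ^ (-(1 : ℝ) / 2) * (Real.exp (-s) / (1 - Real.exp (-2 * s))) ^ ((1 : ℝ) / 2) *
    Real.exp (-((x - Real.exp (-s) * y) ^ 2 + (y - Real.exp (-s) * x) ^ 2) /
      (2 * (1 - Real.exp (-2 * s))))

/-- The Bessel-Clifford series. -/
noncomputable def clif (b t : ℝ) : ℝ :=
  ∑' k : ℕ, t ^ k / ((Nat.factorial k : ℝ) * Real.Gamma ((k : ℝ) + b + 1))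

lemma clif_inv_bound (b : ℝ) (hb : -1 < b) :
    ∃ D > 0, ∀ k : ℕ, (Real.Gamma ((k : ℝ) + b + 1))⁻¹ ≤ D := by
  have h0 : 0 < Real.Gamma (b + 1) := Real.Gamma_pos_of_pos (by linarith)
  have h1 : 0 < Real.Gamma (b + 2) := Real.Gamma_pos_of_pos (by linarith)
  refine ⟨(Real.Gamma (b + 1))⁻¹ + (Real.Gamma (b + 2))⁻¹, by positivity, ?_⟩
  have key : ∀ k : ℕ, (Real.Gamma (((k + 1 : ℕ) : ℝ) + b + 1))⁻¹ ≤ (Real.Gamma (b + 2))⁻¹ := by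
    intro k
    induction k with
    | zero =>
      apply le_of_eq
      congr 2
      push_cast
      ring
    | succ k ih =>
      refine le_trans ?_ ih
      have hk : (0 : ℝ) ≤ k := Nat.cast_nonneg k
      have e : (((k + 1 + 1 : ℕ) : ℝ) + b + 1) = (((k + 1 : ℕ) : ℝ) + b + 1) + 1 := by
        push_cast; ring
      have hp : 0 < (((k + 1 : ℕ) : ℝ) + b + 1) := by push_cast; linarith
      have hp1 : 1 ≤ (((k + 1 : ℕ) : ℝ) + b + 1) := by push_cast; linarith
      rw [e, Real.Gamma_add_one hp.ne']
      have hg := Real.Gamma_pos_of_pos hp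
      apply inv_anti₀ hg
      nlinarith
  intro k
  cases k with
  | zero =>
    have : ((0 : ℕ) : ℝ) + b + 1 = b + 1 := by simp
    rw [this]
    have := inv_pos.2 h1
    linarith
  | succ k =>
    have := key k
    have := inv_pos.2 h0
    linarith

lemma clif_summable (b : ℝ) (hb : -1 < b) (t : ℝ) :
    Summable fun k : ℕ => t ^ k / ((Nat.factorial k : ℝ) * Real.Gamma ((k : ℝ) + b + 1)) := by
  obtain ⟨D, hD, h⟩ := clif_inv_bound b hb
  refine Summable.of_norm_bounded ((Real.summable_pow_div_factorial |t|).mul_right D) ?_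
  intro k
  have hg : 0 < Real.Gamma ((k : ℝ) + b + 1) := Real.Gamma_pos_of_pos (by
    have : (0 : ℝ) ≤ k := Nat.cast_nonneg k
    linarith)
  rw [Real.norm_eq_abs, abs_div, abs_pow, abs_mul, abs_of_pos hg, Nat.abs_cast,
    ← div_div, div_eq_mul_inv _ (Real.Gamma _)]
  exact mul_le_mul_of_nonneg_left (h k) (by positivity)

lemma clif_hasDerivAt (b : ℝ) (hb : -1 < b) (t : ℝ) :
    HasDerivAt (clif b) (clif (b + 1) t) t := by
  obtain ⟨D, hD, h⟩ := clif_inv_bound b hb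
  set R : ℝ := |t| + 1 with hR
  have hterm : ∀ (k : ℕ) (y : ℝ),
      ((k + 1 : ℕ) : ℝ) * y ^ k / ((Nat.factorial (k + 1) : ℝ) *
        Real.Gamma (((k + 1 : ℕ) : ℝ) + b + 1))
      = y ^ k / ((Nat.factorial k : ℝ) * Real.Gamma ((k : ℝ) + (b + 1) + 1)) := by
    intro k y
    have e : (((k + 1 : ℕ) : ℝ) + b + 1) = (k : ℝ) + (b + 1) + 1 := by push_cast; ring
    rw [e, Nat.factorial_succ, Nat.cast_mul, mul_assoc, mul_div_mul_left]
    positivity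
  have hu : Summable fun k : ℕ => (k : ℝ) * R ^ (k - 1) / (Nat.factorial k : ℝ) * D := by
    rw [← summable_nat_add_iff 1]
    refine ((Real.summable_pow_div_factorial R).mul_right D).congr ?_
    intro k
    simp only [Nat.add_sub_cancel]
    rw [Nat.factorial_succ, Nat.cast_mul, mul_div_mul_left]
    positivity
  have hmain := hasDerivAt_tsum_of_isPreconnected (u := fun k : ℕ =>
      (k : ℝ) * R ^ (k - 1) / (Nat.factorial k : ℝ) * D)
    (g := fun (k : ℕ) (y : ℝ) => y ^ k / ((Nat.factorial k : ℝ) * Real.Gamma ((k : ℝ) + b + 1)))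
    (g' := fun (k : ℕ) (y : ℝ) =>
      (k : ℝ) * y ^ (k - 1) / ((Nat.factorial k : ℝ) * Real.Gamma ((k : ℝ) + b + 1)))
    (t := Metric.ball (0 : ℝ) R) (y₀ := 0) (y := t) hu Metric.isOpen_ball
    (convex_ball (0 : ℝ) R).isPreconnected
    (fun k y _ => (hasDerivAt_pow k y).div_const _)
    (by
      intro k y hy
      have hy' : |y| ≤ R := by
        have := Metric.mem_ball.1 hy
        rw [Real.dist_eq, sub_zero] at this
        exact this.le
      have hg : 0 < Real.Gamma ((k : ℝ) + b + 1) := Real.Gamma_pos_of_pos (by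
        have : (0 : ℝ) ≤ k := Nat.cast_nonneg k
        linarith)
      rw [Real.norm_eq_abs, abs_div, abs_mul, abs_pow, abs_mul, abs_of_pos hg, Nat.abs_cast,
        Nat.abs_cast, ← div_div, div_eq_mul_inv _ (Real.Gamma _)]
      have := h k
      gcongr)
    (Metric.mem_ball_self (by positivity))
    (clif_summable b hb 0)
    (by
      rw [Metric.mem_ball, Real.dist_eq, sub_zero]
      linarith)
  have hval : (∑' k : ℕ, (k : ℝ) * t ^ (k - 1) /
      ((Nat.factorial k : ℝ) * Real.Gamma ((k : ℝ) + b + 1))) = clif (b + 1) t := by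
    have hs : Summable fun k : ℕ => (k : ℝ) * t ^ (k - 1) /
      ((Nat.factorial k : ℝ) * Real.Gamma ((k : ℝ) + b + 1)) := by
      rw [← summable_nat_add_iff 1]
      refine (clif_summable (b + 1) (by linarith) t).congr ?_
      intro k
      exact (hterm k t).symm
    rw [hs.tsum_eq_zero_add]
    simp only [Nat.cast_zero, zero_mul, zero_div, zero_add, Nat.add_sub_cancel]
    exact tsum_congr fun k => hterm k t
  rw [← hval]
  exact hmain

lemma clif_rec (b : ℝ) (hb : -1 < b) (t : ℝ) :
    t * clif (b + 1 + 1) t + (b + 1) * clif (b + 1) t = clif b t := by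
  have s0 := clif_summable b hb t
  have s1 := clif_summable (b + 1) (by linarith) t
  have s2 := clif_summable (b + 1 + 1) (by linarith) t
  unfold clif
  rw [s0.tsum_eq_zero_add, s1.tsum_eq_zero_add, ← tsum_mul_left, mul_add, ← tsum_mul_left,
    add_left_comm, ← (s2.mul_left t).tsum_add (((summable_nat_add_iff 1).2 s1).mul_left (b + 1))]
  congr 1
  · simp only [Nat.cast_zero, zero_add, pow_zero, Nat.factorial_zero, Nat.cast_one, one_mul]
    have hp : 0 < b + 1 := by linarith
    have := Real.Gamma_pos_of_pos hp
    rw [Real.Gamma_add_one hp.ne']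
    field_simp
  · refine tsum_congr fun k => ?_
    have hk : (0 : ℝ) ≤ k := Nat.cast_nonneg k
    have hp : 0 < (k : ℝ) + b + 2 := by linarith
    have hg := Real.Gamma_pos_of_pos hp
    have e1 : (k : ℝ) + (b + 1 + 1) + 1 = ((k : ℝ) + b + 2) + 1 := by ring
    have e2 : ((k + 1 : ℕ) : ℝ) + (b + 1) + 1 = ((k : ℝ) + b + 2) + 1 := by push_cast; ring
    have e3 : ((k + 1 : ℕ) : ℝ) + b + 1 = (k : ℝ) + b + 2 := by push_cast; ring
    rw [e1, e2, e3, Real.Gamma_add_one hp.ne', Nat.factorial_succ]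
    push_cast
    have hf : (0 : ℝ) < (Nat.factorial k : ℝ) := by positivity
    field_simp
    ring

/-- The function `√x I_a(x)` without its constant. -/
noncomputable def bF (a x : ℝ) : ℝ := x ^ (a + 1 / 2) * clif a (x ^ 2 / 4)

/-- The derivative of `bF`. -/
noncomputable def bG (a x : ℝ) : ℝ :=
  (a + 1 / 2) * x ^ (a - 1 / 2) * clif a (x ^ 2 / 4)
    + x ^ (a + 1 / 2) * (clif (a + 1) (x ^ 2 / 4) * (x / 2))

lemma clif_sq_hasDerivAt (b : ℝ) (hb : -1 < b) (x : ℝ) :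
    HasDerivAt (fun x : ℝ => clif b (x ^ 2 / 4)) (clif (b + 1) (x ^ 2 / 4) * (x / 2)) x := by
  have h1 : HasDerivAt (fun x : ℝ => x ^ 2 / 4) (x / 2) x := by
    refine ((hasDerivAt_pow 2 x).div_const 4).congr_deriv ?_
    norm_num
    ring
  exact (clif_hasDerivAt b hb (x ^ 2 / 4)).comp x h1

lemma bF_hasDerivAt (a : ℝ) (ha : -1 < a) (x : ℝ) (hx : 0 < x) :
    HasDerivAt (bF a) (bG a x) x := by
  have h1 : HasDerivAt (fun x : ℝ => x ^ (a + 1 / 2)) ((a + 1 / 2) * x ^ (a + 1 / 2 - 1)) x :=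
    Real.hasDerivAt_rpow_const (Or.inl hx.ne')
  have e : a + 1 / 2 - 1 = a - 1 / 2 := by ring
  rw [e] at h1
  exact h1.mul (clif_sq_hasDerivAt a ha x)

lemma bG_hasDerivAt (a : ℝ) (ha : -1 < a) (x : ℝ) (hx : 0 < x) :
    HasDerivAt (bG a) ((1 + (a ^ 2 - 1 / 4) / x ^ 2) * bF a x) x := by
  have h1 : HasDerivAt (fun x : ℝ => x ^ (a + 1 / 2)) ((a + 1 / 2) * x ^ (a + 1 / 2 - 1)) x :=
    Real.hasDerivAt_rpow_const (Or.inl hx.ne')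
  have h2 : HasDerivAt (fun x : ℝ => x ^ (a - 1 / 2)) ((a - 1 / 2) * x ^ (a - 1 / 2 - 1)) x :=
    Real.hasDerivAt_rpow_const (Or.inl hx.ne')
  have h3 : HasDerivAt (fun x : ℝ => x / 2) (1 / 2) x := (hasDerivAt_id x).div_const 2
  have h := ((h2.const_mul (a + 1 / 2)).mul (clif_sq_hasDerivAt a ha x)).add
    (h1.mul ((clif_sq_hasDerivAt (a + 1) (by linarith) x).mul h3))
  refine h.congr_deriv ?_
  have r := clif_rec a ha (x ^ 2 / 4)
  have e1 : x ^ (a + 1 / 2 - 1) = x ^ (a + 1 / 2) / x := Real.rpow_sub_one hx.ne' _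
  have e2 : x ^ (a - 1 / 2) = x ^ (a + 1 / 2) / x := by rw [← e1]; congr 1; ring
  have e3 : x ^ (a - 1 / 2 - 1) = x ^ (a + 1 / 2) / x / x := by
    rw [Real.rpow_sub_one hx.ne', e2]
  simp only [bF]
  simp only [Pi.mul_apply]
  rw [e1, e3, e2]
  generalize clif a (x ^ 2 / 4) = A at *
  generalize clif (a + 1) (x ^ 2 / 4) = B at *
  generalize clif (a + 1 + 1) (x ^ 2 / 4) = E at *
  have rE : E = 4 / x ^ 2 * (A - (a + 1) * B) := by
    rw [← r]
    field_simp
    ring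
  rw [rE]
  field_simp
  ring

lemma besselI_eq (a x : ℝ) (hx : 0 < x) :
    x ^ ((1 : ℝ) / 2) * besselI a x = (2 : ℝ) ^ (-a) * bF a x := by
  have h : besselI a x = (x / 2) ^ a * clif a (x ^ 2 / 4) := by
    unfold besselI clif
    rw [← tsum_mul_left]
    refine tsum_congr fun k => ?_
    have h2 : 0 < x / 2 := by positivity
    rw [Real.rpow_add h2, Real.rpow_mul h2.le, Real.rpow_natCast, Real.rpow_two]
    have : (x / 2) ^ 2 = x ^ 2 / 4 := by ring
    rw [this]
    ring
  rw [h, Real.div_rpow hx.le (by norm_num), bF, Real.rpow_add hx, Real.rpow_neg (by norm_num)]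
  ring

lemma bF_bound (a : ℝ) (ha : -1 < a) :
    ∃ C > 0, ∀ x : ℝ, 2 ≤ x → |bF a x| ≤ C * Real.exp x ∧ |bG a x| ≤ C * Real.exp x := by
  set c : ℝ := |a ^ 2 - 1 / 4| with hc
  have hc0 : 0 ≤ c := abs_nonneg _
  let H : ℝ → ℝ := fun x => (bF a x ^ 2 + bG a x ^ 2) * Real.exp (-2 * x + c / x)
  have hd : ∀ x : ℝ, 0 < x → HasDerivAt H
      ((2 * bF a x * bG a x + 2 * bG a x * ((1 + (a ^ 2 - 1 / 4) / x ^ 2) * bF a x))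
        * Real.exp (-2 * x + c / x) + (bF a x ^ 2 + bG a x ^ 2) *
        (Real.exp (-2 * x + c / x) * (-2 - c / x ^ 2))) x := by
    intro x hx
    have h1 := (bF_hasDerivAt a ha x hx).pow 2
    have h2 := (bG_hasDerivAt a ha x hx).pow 2
    have h3 : HasDerivAt (fun x : ℝ => -2 * x + c / x) (-2 - c / x ^ 2) x := by
      have h4 := ((hasDerivAt_id x).const_mul (-2)).add ((hasDerivAt_inv hx.ne').const_mul c)
      refine (h4.congr_deriv ?_)
      field_simp
      ring
    refine ((h1.add h2).mul h3.exp).congr_deriv ?_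
    simp
  have hanti : AntitoneOn H (Set.Ici 2) := by
    refine antitoneOn_of_deriv_nonpos (convex_Ici 2) ?_ ?_ ?_
    · intro x hx
      have : (2 : ℝ) ≤ x := hx
      exact (hd x (by linarith)).continuousAt.continuousWithinAt
    · intro x hx
      rw [interior_Ici] at hx
      have : (2 : ℝ) < x := hx
      exact (hd x (by linarith)).differentiableAt.differentiableWithinAt
    · intro x hx
      rw [interior_Ici] at hx
      have hx2 : (2 : ℝ) < x := hx
      have hx0 : 0 < x := by linarith
      rw [(hd x hx0).deriv]
      generalize bF a x = f
      generalize bG a x = g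
      have hE := Real.exp_pos (-2 * x + c / x)
      generalize Real.exp (-2 * x + c / x) = E at *
      have hq : |(a ^ 2 - 1 / 4) / x ^ 2| = c / x ^ 2 := by
        rw [abs_div, abs_of_pos (by positivity : (0 : ℝ) < x ^ 2)]
      have hd0 : 0 ≤ c / x ^ 2 := by positivity
      generalize (a ^ 2 - 1 / 4) / x ^ 2 = d at *
      generalize c / x ^ 2 = d' at *
      have hd1 := abs_le.1 hq.le
      have : 2 * f * g + 2 * g * ((1 + d) * f) - (f ^ 2 + g ^ 2) * (2 + d') ≤ 0 := by
        have k1 : 2 * f * g * d ≤ (f ^ 2 + g ^ 2) * d' := by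
          calc 2 * f * g * d ≤ |2 * f * g * d| := le_abs_self _
            _ = |2 * f * g| * d' := by rw [abs_mul, hq]
            _ ≤ _ := by
              apply mul_le_mul_of_nonneg_right _ hd0
              rw [abs_le]
              constructor <;> nlinarith [sq_nonneg (f - g), sq_nonneg (f + g)]
        nlinarith [sq_nonneg (f - g)]
      nlinarith
  have hH0 : 0 ≤ H 2 := by positivity
  have key : ∀ x : ℝ, 2 ≤ x → bF a x ^ 2 + bG a x ^ 2 ≤ ((H 2 + 1) * Real.exp x) ^ 2 := by
    intro x hx
    have h1 : H x ≤ H 2 := hanti (Set.mem_Ici.2 le_rfl) (Set.mem_Ici.2 hx) hx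
    have h2 : (bF a x ^ 2 + bG a x ^ 2) * Real.exp (-2 * x) ≤ H x := by
      apply mul_le_mul_of_nonneg_left _ (by positivity)
      apply Real.exp_le_exp.2
      have : 0 ≤ c / x := by positivity
      linarith
    have h3 : Real.exp (-2 * x) * (Real.exp x) ^ 2 = 1 := by
      rw [← Real.exp_nat_mul, ← Real.exp_add]
      simp
    have h4 : bF a x ^ 2 + bG a x ^ 2 ≤ H 2 * (Real.exp x) ^ 2 := by
      calc _ = (bF a x ^ 2 + bG a x ^ 2) * (Real.exp (-2 * x) * (Real.exp x) ^ 2) := by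
            rw [h3, mul_one]
        _ = (bF a x ^ 2 + bG a x ^ 2) * Real.exp (-2 * x) * (Real.exp x) ^ 2 := by ring
        _ ≤ _ := mul_le_mul_of_nonneg_right (h2.trans h1) (by positivity)
    refine h4.trans ?_
    rw [mul_pow]
    apply mul_le_mul_of_nonneg_right _ (by positivity)
    nlinarith
  refine ⟨H 2 + 1, by linarith, fun x hx => ⟨?_, ?_⟩⟩
  · apply abs_le_of_sq_le_sq _ (by positivity)
    nlinarith [key x hx, sq_nonneg (bG a x)]
  · apply abs_le_of_sq_le_sq _ (by positivity)
    nlinarith [key x hx, sq_nonneg (bF a x)]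

lemma rho_hasDerivAt (s : ℝ) (hs : 0 < s) :
    HasDerivAt (fun s : ℝ => Real.exp (-s) / (1 - Real.exp (-2 * s)))
      (-(Real.exp (-s) / (1 - Real.exp (-2 * s))) *
        ((1 + Real.exp (-2 * s)) / (1 - Real.exp (-2 * s)))) s ∧
    HasDerivAt (fun s : ℝ => (1 + Real.exp (-2 * s)) / (1 - Real.exp (-2 * s)))
      (-4 * Real.exp (-2 * s) / (1 - Real.exp (-2 * s)) ^ 2) s := by
  have hq : 0 < 1 - Real.exp (-2 * s) := by
    have : Real.exp (-2 * s) < 1 := (by rw [← Real.exp_zero]; exact Real.exp_lt_exp.2 (by linarith))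
    linarith
  have h1 : HasDerivAt (fun s : ℝ => Real.exp (-s)) (-Real.exp (-s)) s := by
    refine ((hasDerivAt_id s).neg.exp).congr_deriv ?_
    simp
  have h2 : HasDerivAt (fun s : ℝ => Real.exp (-2 * s)) (-2 * Real.exp (-2 * s)) s := by
    refine (((hasDerivAt_id s).const_mul (-2)).exp).congr_deriv ?_
    simp
    ring
  constructor
  · refine (h1.div (h2.const_sub 1) hq.ne').congr_deriv ?_
    field_simp
    ring
  · refine ((h2.const_add 1).div (h2.const_sub 1) hq.ne').congr_deriv ?_
    field_simp
    ring

lemma kernel_hasDerivAt (a : ℝ) (ha : -1 < a) (s y z : ℝ) (hs : 0 < s) (hy : 0 < y) (hz : 0 < z)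
    (ρ E x : ℝ) (hρ : ρ = Real.exp (-s) / (1 - Real.exp (-2 * s)))
    (hE : E = (1 + Real.exp (-2 * s)) / (1 - Real.exp (-2 * s))) (hx : x = 2 * y * z * ρ) :
    HasDerivAt (fun s => laguerreHeatKernel a s y z)
      ((2 * ρ) ^ ((1 : ℝ) / 2) * (2 : ℝ) ^ (-a) * Real.exp (-(1 / 2) * (y ^ 2 + z ^ 2) * E) *
        (-(1 / 2) * E * bF a x - x * E * bG a x
          + 2 * (y ^ 2 + z ^ 2) * ρ ^ 2 * bF a x)) s := by
  have hqpos : ∀ s : ℝ, 0 < s → 0 < 1 - Real.exp (-2 * s) := by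
    intro s hs
    have : Real.exp (-2 * s) < 1 := (by rw [← Real.exp_zero]; exact Real.exp_lt_exp.2 (by linarith))
    linarith
  have hq := hqpos s hs
  obtain ⟨d1, d2⟩ := rho_hasDerivAt s hs
  have hρ0 : 0 < ρ := by rw [hρ]; positivity
  have hx0 : 0 < x := by rw [hx]; positivity
  have hsq : -4 * Real.exp (-2 * s) / (1 - Real.exp (-2 * s)) ^ 2 = -4 * ρ ^ 2 := by
    have : Real.exp (-2 * s) = Real.exp (-s) ^ 2 := by
      rw [← Real.exp_nat_mul]; congr 1; push_cast; ring
    rw [hρ, div_pow, ← this]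
    ring
  rw [hsq] at d2
  rw [← hρ, ← hE] at d1
  have e1 : HasDerivAt (fun s : ℝ => (2 * (Real.exp (-s) / (1 - Real.exp (-2 * s)))) ^ ((1 : ℝ) / 2))
      (-(1 / 2) * E * (2 * ρ) ^ ((1 : ℝ) / 2)) s := by
    have := (d1.const_mul 2).rpow_const (p := (1 : ℝ) / 2) (Or.inl (by rw [← hρ]; positivity))
    refine this.congr_deriv ?_
    rw [← hρ, Real.rpow_sub_one (by positivity)]
    field_simp
  have e2 : HasDerivAt (fun s : ℝ => bF a (2 * y * z * (Real.exp (-s) / (1 - Real.exp (-2 * s)))))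
      (bG a x * (-x * E)) s := by
    have hb := bF_hasDerivAt a ha x hx0
    have hi := d1.const_mul (2 * y * z)
    have := HasDerivAt.comp s (h₂ := bF a) (h₂' := bG a x) (by rw [← hρ, ← hx]; exact hb) hi
    refine this.congr_deriv ?_
    rw [hx]
    ring
  have e3 : HasDerivAt (fun s : ℝ => Real.exp (-(1 / 2) * (y ^ 2 + z ^ 2) *
      ((1 + Real.exp (-2 * s)) / (1 - Real.exp (-2 * s)))))
      (Real.exp (-(1 / 2) * (y ^ 2 + z ^ 2) * E) * (-(1 / 2) * (y ^ 2 + z ^ 2) * (-4 * ρ ^ 2))) s := by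
    have := (d2.const_mul (-(1 / 2) * (y ^ 2 + z ^ 2))).exp
    rwa [← hE] at this
  have e := (e1.mul (e2.const_mul ((2 : ℝ) ^ (-a)))).mul e3
  have hev : (fun s => laguerreHeatKernel a s y z) =ᶠ[nhds s] fun s =>
      (2 * (Real.exp (-s) / (1 - Real.exp (-2 * s)))) ^ ((1 : ℝ) / 2) *
      ((2 : ℝ) ^ (-a) * bF a (2 * y * z * (Real.exp (-s) / (1 - Real.exp (-2 * s))))) *
      Real.exp (-(1 / 2) * (y ^ 2 + z ^ 2) *
      ((1 + Real.exp (-2 * s)) / (1 - Real.exp (-2 * s)))) := by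
    filter_upwards [lt_mem_nhds hs] with t ht
    have hqt := hqpos t ht
    unfold laguerreHeatKernel
    rw [← besselI_eq a _ (by positivity), mul_div_assoc 2 (Real.exp (-t)),
      mul_div_assoc (2 * y * z), mul_div_assoc (-(1 / 2) * (y ^ 2 + z ^ 2)), mul_assoc (_ ^ _) (_ ^ _)]
  refine HasDerivAt.congr_of_eventuallyEq ?_ hev
  refine e.congr_deriv ?_
  simp only [Pi.mul_apply]
  rw [← hρ, ← hE, ← hx]
  ring

set_option maxHeartbeats 1000000 in
theorem stmt14 (a : ℝ) (ha : -(1 / 2) < a) :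
    ∃ C > 0, ∀ s y z : ℝ, 0 < s → 0 < y → 0 < z →
      1 ≤ y * z * Real.exp (-s) / (1 - Real.exp (-2 * s)) →
        |deriv (fun s => laguerreHeatKernel a s y z) s| ≤
          C * Real.exp (-((z - Real.exp (-s) * y) ^ 2 + (y - Real.exp (-s) * z) ^ 2) /
              (2 * (1 - Real.exp (-2 * s)))) *
            Real.exp (-3 * s / 2) * (1 - Real.exp (-2 * s)) ^ (-(5 : ℝ) / 2) *
            (y ^ 2 + z ^ 2) := by
  have ha' : -1 < a := by linarith
  obtain ⟨C, hC, hb⟩ := bF_bound a ha'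
  have h2a : (0 : ℝ) < (2 : ℝ) ^ (-a) := by positivity
  refine ⟨(2 : ℝ) ^ ((1 : ℝ) / 2) * (2 : ℝ) ^ (-a) * (C * 5), by positivity, ?_⟩
  intro s y z hs hy hz h1
  have hr := Real.exp_pos (-s)
  have hr1 : Real.exp (-s) < 1 := (by rw [← Real.exp_zero]; exact Real.exp_lt_exp.2 (by linarith))
  have hrr : Real.exp (-2 * s) = Real.exp (-s) ^ 2 := by
    rw [← Real.exp_nat_mul]; congr 1; push_cast; ring
  rw [(kernel_hasDerivAt a ha' s y z hs hy hz _ _ _ rfl rfl rfl).deriv]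
  have h32 : Real.exp (-3 * s / 2) = Real.exp (-s) ^ ((1 : ℝ) / 2) * Real.exp (-s) := by
    rw [← Real.exp_mul, ← Real.exp_add]; congr 1; ring
  rw [h32]
  rw [hrr] at h1 ⊢
  generalize Real.exp (-s) = r at *
  have hq : 0 < 1 - r ^ 2 := by nlinarith
  obtain ⟨q, hqd⟩ : ∃ q, q = 1 - r ^ 2 := ⟨_, rfl⟩
  rw [← hqd] at hq h1 ⊢
  have h52 : q ^ (-(5 : ℝ) / 2) = q⁻¹ ^ ((1 : ℝ) / 2) * (q ^ 2)⁻¹ := by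
    rw [Real.inv_rpow hq.le, ← Real.rpow_neg hq.le, ← Real.rpow_natCast q 2,
      ← Real.rpow_neg hq.le, ← Real.rpow_add hq]
    congr 1
    norm_num
  have hx : 2 ≤ 2 * y * z * (r / q) := by
    have : 2 * y * z * (r / q) = 2 * (y * z * r / q) := by ring
    linarith
  obtain ⟨b1, b2⟩ := hb _ hx
  have hexp : Real.exp (-((z - r * y) ^ 2 + (y - r * z) ^ 2) / (2 * q))
      = Real.exp (-(1 / 2) * (y ^ 2 + z ^ 2) * ((1 + r ^ 2) / q)) *
        Real.exp (2 * y * z * (r / q)) := by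
    rw [← Real.exp_add]
    congr 1
    field_simp
    ring
  have hroot : (2 * (r / q)) ^ ((1 : ℝ) / 2)
      = (2 : ℝ) ^ ((1 : ℝ) / 2) * (r ^ ((1 : ℝ) / 2) * q⁻¹ ^ ((1 : ℝ) / 2)) := by
    rw [div_eq_mul_inv, Real.mul_rpow (by norm_num) (by positivity),
      Real.mul_rpow hr.le (by positivity)]
  rw [hexp, hroot, h52]
  have hX := Real.exp_pos (2 * y * z * (r / q))
  have hY := Real.exp_pos (-(1 / 2) * (y ^ 2 + z ^ 2) * ((1 + r ^ 2) / q))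
  generalize Real.exp (2 * y * z * (r / q)) = X at *
  generalize Real.exp (-(1 / 2) * (y ^ 2 + z ^ 2) * ((1 + r ^ 2) / q)) = Y at *
  have hR : 0 < r ^ ((1 : ℝ) / 2) := by positivity
  have hQ : 0 < q⁻¹ ^ ((1 : ℝ) / 2) := by positivity
  have h22 : (0 : ℝ) < (2 : ℝ) ^ ((1 : ℝ) / 2) := by positivity
  generalize r ^ ((1 : ℝ) / 2) = R at *
  generalize q⁻¹ ^ ((1 : ℝ) / 2) = Q at *
  generalize (2 : ℝ) ^ ((1 : ℝ) / 2) = T at *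
  generalize (2 : ℝ) ^ (-a) = K at *
  generalize bF a (2 * y * z * (r / q)) = F at *
  generalize bG a (2 * y * z * (r / q)) = G at *
  -- the scale against which everything is measured
  set M : ℝ := r * (q ^ 2)⁻¹ * (y ^ 2 + z ^ 2) with hM
  have hM0 : 0 < M := by positivity
  have hyz : 2 * (y * z) ≤ y ^ 2 + z ^ 2 := by nlinarith [sq_nonneg (y - z)]
  have hmid : 2 * (y * z) * (r * (q ^ 2)⁻¹) ≤ M := by
    rw [hM, mul_comm (r * (q ^ 2)⁻¹)]
    exact mul_le_mul_of_nonneg_right hyz (by positivity)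
  have hE : (1 + r ^ 2) / q ≤ 2 / q := by
    apply div_le_div_of_nonneg_right _ hq.le
    nlinarith
  have hE0 : 0 < (1 + r ^ 2) / q := by positivity
  have c1 : (1 + r ^ 2) / q ≤ M := by
    refine hE.trans (le_trans ?_ hmid)
    have : 2 * (y * z) * (r * (q ^ 2)⁻¹) = 2 / q * (y * z * r / q) := by
      field_simp
    rw [this]
    exact le_mul_of_one_le_right (by positivity) h1
  have c2 : 2 * y * z * (r / q) * ((1 + r ^ 2) / q) ≤ 2 * M := by
    calc 2 * y * z * (r / q) * ((1 + r ^ 2) / q) ≤ 2 * y * z * (r / q) * (2 / q) :=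
          mul_le_mul_of_nonneg_left hE (by positivity)
      _ = 2 * (2 * (y * z) * (r * (q ^ 2)⁻¹)) := by field_simp
      _ ≤ 2 * M := by linarith
  have c3 : 2 * (y ^ 2 + z ^ 2) * (r / q) ^ 2 ≤ 2 * M := by
    have : 2 * (y ^ 2 + z ^ 2) * (r / q) ^ 2 = 2 * M * r := by rw [hM]; field_simp
    rw [this]
    exact mul_le_of_le_one_right (by positivity) hr1.le
  have hXC : 0 < C * X := by positivity
  have hbr : |-(1 / 2) * ((1 + r ^ 2) / q) * F - 2 * y * z * (r / q) * ((1 + r ^ 2) / q) * G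
      + 2 * (y ^ 2 + z ^ 2) * (r / q) ^ 2 * F| ≤ 5 * M * (C * X) := by
    have k1 : |-(1 / 2) * ((1 + r ^ 2) / q) * F| ≤ M * (C * X) := by
      rw [abs_mul]
      refine mul_le_mul ?_ b1 (abs_nonneg _) hM0.le
      rw [abs_of_nonpos (by linarith)]
      linarith
    have k2 : |2 * y * z * (r / q) * ((1 + r ^ 2) / q) * G| ≤ 2 * M * (C * X) := by
      rw [abs_mul]
      refine mul_le_mul ?_ b2 (abs_nonneg _) (by positivity)
      rwa [abs_of_nonneg (by positivity)]
    have k3 : |2 * (y ^ 2 + z ^ 2) * (r / q) ^ 2 * F| ≤ 2 * M * (C * X) := by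
      rw [abs_mul]
      refine mul_le_mul ?_ b1 (abs_nonneg _) (by positivity)
      rwa [abs_of_nonneg (by positivity)]
    have k := add_le_add (add_le_add k1 k2) k3
    refine (abs_add_le _ _).trans (le_trans (add_le_add (abs_sub _ _) le_rfl) (k.trans ?_))
    apply le_of_eq
    ring
  rw [abs_mul, abs_of_pos (by positivity : 0 < T * (R * Q) * K * Y)]
  calc T * (R * Q) * K * Y * _ ≤ T * (R * Q) * K * Y * (5 * M * (C * X)) :=
        mul_le_mul_of_nonneg_left hbr (by positivity)
    _ = _ := by rw [hM]; ring
end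

section
/- Let q ≥ 2 and α > -1/2. There is a constant C > 0 such that for 0 < x/2 < z < 2x, (∫_{Γ₊(x)} |(s ∂/∂s (W_s^α(y,z) - W_s(y,z)))|_{s=t²}|^q dt dy/t²)^{1/q} ≤ (C/z)(1 + √(z/|z - x|)), where Γ₊(x) = {(y,t) ∈ (0,∞)² : |y-x| < t}, W_s^α is the Laguerre heat kernel and W_s the Hermite heat kernel. -/
open MeasureTheory Real

lemma beta_aux (u v : ℝ) (hu : 0 < u) (hv : 0 < v) :
    IntegrableOn (fun x : ℝ => x ^ (u - 1) * (1 - x) ^ (v - 1)) (Set.Ioo 0 1) ∧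
    ∫ x in Set.Ioo (0:ℝ) 1, x ^ (u - 1) * (1 - x) ^ (v - 1)
      = Real.Gamma u * Real.Gamma v / Real.Gamma (u + v) := by
  have h1 := Complex.betaIntegral_convergent (u := u) (v := v) (by simpa) (by simpa)
  have h2 := ProbabilityTheory.beta_eq_betaIntegralReal u v hu hv
  rw [intervalIntegrable_iff_integrableOn_Ioo_of_le zero_le_one] at h1
  have hpt : ∀ x ∈ Set.Ioo (0:ℝ) 1, ((x:ℂ) ^ ((u:ℂ) - 1) * (1 - (x:ℂ)) ^ ((v:ℂ) - 1))
      = ((x ^ (u - 1) * (1 - x) ^ (v - 1) : ℝ) : ℂ) := by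
    intro x hx
    push_cast
    rw [Complex.ofReal_cpow hx.1.le, Complex.ofReal_cpow (by linarith [hx.2])]
    push_cast
    rfl
  have h3 : IntegrableOn (fun x : ℝ => ((x ^ (u - 1) * (1 - x) ^ (v - 1) : ℝ) : ℂ)) (Set.Ioo 0 1) :=
    h1.congr_fun hpt measurableSet_Ioo
  refine ⟨by simpa [IntegrableOn] using h3.re, ?_⟩
  have h4 : ProbabilityTheory.beta u v = Real.Gamma u * Real.Gamma v / Real.Gamma (u + v) := rfl
  rw [← h4, h2, Complex.betaIntegral, intervalIntegral.integral_of_le zero_le_one,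
    integral_Ioc_eq_integral_Ioo, setIntegral_congr_fun measurableSet_Ioo hpt, integral_complex_ofReal]
  simp

lemma R1 (p : ℝ) (hp : 0 < p) (ξ : ℝ) :
    HasSum (fun k : ℕ => ξ ^ (2 * k) / ((2 * k).factorial : ℝ) *
        (Real.Gamma (k + 1 / 2) * Real.Gamma p / Real.Gamma (k + 1 / 2 + p)))
      (∫ t in Set.Ioo (0:ℝ) 1, Real.cosh (ξ * √t) * (t ^ ((1:ℝ) / 2 - 1) * (1 - t) ^ (p - 1))) := by
  have key := hasSum_integral_of_dominated_convergence (μ := volume.restrict (Set.Ioo (0:ℝ) 1))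
    (F := fun (k : ℕ) t => (ξ * √t) ^ (2 * k) / ((2 * k).factorial : ℝ) *
      (t ^ ((1:ℝ) / 2 - 1) * (1 - t) ^ (p - 1)))
    (f := fun t => Real.cosh (ξ * √t) * (t ^ ((1:ℝ) / 2 - 1) * (1 - t) ^ (p - 1)))
    (fun (k : ℕ) t => ξ ^ (2 * k) / ((2 * k).factorial : ℝ) *
      (t ^ ((1:ℝ) / 2 - 1) * (1 - t) ^ (p - 1))) ?_ ?_ ?_ ?_ ?_
  · have hk : ∀ k : ℕ, ξ ^ (2 * k) / ((2 * k).factorial : ℝ) *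
        (Real.Gamma (k + 1 / 2) * Real.Gamma p / Real.Gamma (k + 1 / 2 + p)) =
        ∫ t in Set.Ioo (0:ℝ) 1, (ξ * √t) ^ (2 * k) / ((2 * k).factorial : ℝ) *
      (t ^ ((1:ℝ) / 2 - 1) * (1 - t) ^ (p - 1)) := ?_
    · simp only [hk]; exact key
    intro k
    have h := (beta_aux (k + 1 / 2) p (by positivity) hp).2
    rw [← h, ← integral_const_mul]
    refine setIntegral_congr_fun measurableSet_Ioo ?_
    intro t ht
    have e : t ^ ((k:ℝ) + 1 / 2 - 1) = t ^ k * t ^ ((1:ℝ) / 2 - 1) := by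
      rw [← Real.rpow_natCast, ← Real.rpow_add ht.1]; ring_nf
    simp only
    rw [e, mul_pow, pow_mul (√t), Real.sq_sqrt ht.1.le]
    ring
  · intro k
    apply Measurable.aestronglyMeasurable
    fun_prop
  · intro k
    refine (ae_restrict_iff' measurableSet_Ioo).2 (Filter.Eventually.of_forall fun t ht => ?_)
    have h1 : 0 ≤ t ^ ((1:ℝ) / 2 - 1) := Real.rpow_nonneg ht.1.le _
    have h2 : 0 ≤ (1 - t) ^ (p - 1) := Real.rpow_nonneg (by linarith [ht.2]) _
    have h3 : (0:ℝ) ≤ (ξ * √t) ^ (2 * k) := by rw [pow_mul]; positivity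
    have h4 : (ξ * √t) ^ (2 * k) ≤ ξ ^ (2 * k) := by
      rw [pow_mul, pow_mul]
      apply pow_le_pow_left₀ (by positivity)
      rw [mul_pow, Real.sq_sqrt ht.1.le]
      nlinarith [ht.2, sq_nonneg ξ]
    rw [Real.norm_of_nonneg (by positivity)]
    gcongr
  · refine Filter.Eventually.of_forall fun t => ?_
    exact (Real.hasSum_cosh ξ).summable.mul_right _
  · have : (fun t : ℝ => ∑' k : ℕ, ξ ^ (2 * k) / ((2 * k).factorial : ℝ) *
      (t ^ ((1:ℝ) / 2 - 1) * (1 - t) ^ (p - 1))) = fun t => Real.cosh ξ * 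
      (t ^ ((1:ℝ) / 2 - 1) * (1 - t) ^ (p - 1)) := by
      ext t
      exact ((Real.hasSum_cosh ξ).mul_right _).tsum_eq
    rw [this]
    exact (beta_aux (1/2) p (by norm_num) hp).1.const_mul _
  · refine Filter.Eventually.of_forall fun t => ?_
    exact (Real.hasSum_cosh _).mul_right _

lemma R2 (p : ℝ) (ξ : ℝ) :
    (∫ t in Set.Ioo (0:ℝ) 1, Real.cosh (ξ * √t) * (t ^ ((1:ℝ) / 2 - 1) * (1 - t) ^ (p - 1)))
    = ∫ u in Set.Ioo (0:ℝ) 1, 2 * Real.cosh (ξ * u) * (1 - u ^ 2) ^ (p - 1) := by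
  have himg : (fun u : ℝ => u ^ 2) '' Set.Ioo 0 1 = Set.Ioo 0 1 := by
    ext t
    constructor
    · rintro ⟨u, ⟨h0, h1⟩, rfl⟩
      exact ⟨by positivity, by simp only; nlinarith⟩
    · rintro ⟨h0, h1⟩
      refine ⟨√t, ⟨by positivity, ?_⟩, Real.sq_sqrt h0.le⟩
      rw [Real.sqrt_lt' one_pos]; simpa
  conv_lhs => rw [← himg]
  rw [integral_image_eq_integral_abs_deriv_smul (f' := fun u => 2 * u) measurableSet_Ioo]
  · refine setIntegral_congr_fun measurableSet_Ioo ?_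
    intro u hu
    have h0 := hu.1
    simp only [smul_eq_mul]
    rw [abs_of_pos (by positivity), Real.sqrt_sq h0.le, ← Real.rpow_natCast u 2, ← Real.rpow_mul h0.le]
    have : u ^ (((2:ℕ):ℝ) * (1/2 - 1)) = u⁻¹ := by
      rw [← Real.rpow_neg_one]; norm_num
    rw [this]
    field_simp
  · intro u hu
    simpa using (hasDerivAt_pow 2 u).hasDerivWithinAt
  · intro u hu v hv h
    have := hu.1; have := hv.1
    simpa using (pow_left_inj₀ hu.1.le hv.1.le two_ne_zero).1 h

lemma R3int (p β : ℝ) (hp : 0 < p) (hβ : -1 < β) :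
    IntegrableOn (fun v : ℝ => v ^ (p - 1) * (1 - v / 2) ^ β) (Set.Ioo 0 2) := by
  have h := (beta_aux p (β + 1) hp (by linarith)).1
  rw [← intervalIntegrable_iff_integrableOn_Ioo_of_le (by norm_num)] at h ⊢
  have h2 := h.comp_mul_left (c := 1 / 2)
  simp only [zero_div, one_div_one_div] at h2
  have h3 := h2.const_mul ((2:ℝ) ^ (p - 1))
  refine h3.congr_ae ?_
  rw [Set.uIoc_of_le (by norm_num)]
  refine (ae_restrict_iff' measurableSet_Ioc).2 (Filter.Eventually.of_forall fun t ht => ?_)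
  have e : t ^ (p - 1) = 2 ^ (p - 1) * (1 / 2 * t) ^ (p - 1) := by
    rw [← Real.mul_rpow (by norm_num) (by linarith [ht.1])]; ring_nf
  simp only
  rw [e]
  ring_nf

/-- the Laplace-type integral -/
noncomputable def JJ (p β ξ : ℝ) : ℝ :=
  ∫ v in Set.Ioo (0:ℝ) 2, Real.exp (-(ξ * v)) * (v ^ (p - 1) * (1 - v / 2) ^ β)

lemma JJint (p β : ℝ) (hp : 0 < p) (hβ : -1 < β) (ξ : ℝ) :
    IntegrableOn (fun v : ℝ => Real.exp (-(ξ * v)) * (v ^ (p - 1) * (1 - v / 2) ^ β)) (Set.Ioo 0 2) := by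
  have h := R3int p β hp hβ
  refine Integrable.bdd_mul (c := Real.exp (2 * |ξ|)) h ?_ ?_
  · apply Measurable.aestronglyMeasurable; fun_prop
  · refine (ae_restrict_iff' measurableSet_Ioo).2 (Filter.Eventually.of_forall fun t ht => ?_)
    rw [Real.norm_of_nonneg (by positivity), Real.exp_le_exp]
    have := neg_abs_le ξ
    nlinarith [ht.1, ht.2, abs_nonneg ξ]

lemma R3 (p : ℝ) (hp : 0 < p) (ξ : ℝ) :
    ∫ u in Set.Ioo (0:ℝ) 1, 2 * Real.cosh (ξ * u) * (1 - u ^ 2) ^ (p - 1)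
     = Real.exp ξ * 2 ^ (p - 1) * JJ p (p - 1) ξ := by
  set f : ℝ → ℝ := fun v => Real.exp (-(ξ * v)) * (v ^ (p - 1) * (1 - v / 2) ^ (p - 1)) with hf
  have hfi : IntervalIntegrable f volume 0 2 :=
    (intervalIntegrable_iff_integrableOn_Ioo_of_le (by norm_num)).2 (JJint p (p-1) hp (by linarith) ξ)
  have hf1 : IntervalIntegrable f volume 0 1 := hfi.mono_set (by
    rw [Set.uIcc_of_le (by norm_num), Set.uIcc_of_le (by norm_num)]
    exact Set.Icc_subset_Icc_right (by norm_num))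
  have hf2 : IntervalIntegrable f volume 1 2 := hfi.mono_set (by
    rw [Set.uIcc_of_le (by norm_num), Set.uIcc_of_le (by norm_num)]
    exact Set.Icc_subset_Icc_left (by norm_num))
  have hJ : JJ p (p - 1) ξ = ∫ v in (0:ℝ)..2, f v := by
    rw [intervalIntegral.integral_of_le (by norm_num), integral_Ioc_eq_integral_Ioo]; rfl
  have e1 : ∫ v in (0:ℝ)..1, f v = ∫ u in (0:ℝ)..1, f (1 - u) := by
    rw [intervalIntegral.integral_comp_sub_left f 1]; norm_num
  have e2 : ∫ v in (1:ℝ)..2, f v = ∫ u in (0:ℝ)..1, f (1 + u) := by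
    rw [intervalIntegral.integral_comp_add_left f 1]; norm_num
  have i1 : IntervalIntegrable (fun u => f (1 - u)) volume 0 1 := by
    have := (hf1.comp_sub_left 1).symm; norm_num at this; exact this
  have i2 : IntervalIntegrable (fun u => f (1 + u)) volume 0 1 := by
    have := (hf2.comp_add_left 1); norm_num at this; exact this
  rw [hJ, ← intervalIntegral.integral_add_adjacent_intervals hf1 hf2, e1, e2,
    ← intervalIntegral.integral_add i1 i2, ← intervalIntegral.integral_const_mul,
    intervalIntegral.integral_of_le (by norm_num), integral_Ioc_eq_integral_Ioo]
  refine setIntegral_congr_fun measurableSet_Ioo ?_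
  intro u hu
  obtain ⟨h0, h1⟩ := hu
  simp only [hf]
  have a1 : (1 - u) ^ (p-1) * (1 - (1 - u)/2) ^ (p-1) * 2 ^ (p-1) = (1 - u^2) ^ (p-1) := by
    rw [← Real.mul_rpow (by linarith) (by linarith), ← Real.mul_rpow (by nlinarith) (by linarith)]
    ring_nf
  have a2 : (1 + u) ^ (p-1) * (1 - (1 + u)/2) ^ (p-1) * 2 ^ (p-1) = (1 - u^2) ^ (p-1) := by
    rw [← Real.mul_rpow (by linarith) (by linarith), ← Real.mul_rpow (by nlinarith) (by linarith)]
    ring_nf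
  have c1 : Real.exp ξ * Real.exp (-(ξ * (1 - u))) = Real.exp (ξ * u) := by
    rw [← Real.exp_add]; ring_nf
  have c2 : Real.exp ξ * Real.exp (-(ξ * (1 + u))) = Real.exp (-(ξ * u)) := by
    rw [← Real.exp_add]; ring_nf
  rw [Real.cosh_eq]
  calc _ = Real.exp (ξ * u) * (1 - u^2) ^ (p-1) + Real.exp (-(ξ * u)) * (1 - u^2) ^ (p-1) := by ring
    _ = Real.exp ξ * Real.exp (-(ξ * (1 - u))) * ((1 - u) ^ (p-1) * (1 - (1 - u)/2) ^ (p-1) * 2 ^ (p-1))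
      + Real.exp ξ * Real.exp (-(ξ * (1 + u))) * ((1 + u) ^ (p-1) * (1 - (1 + u)/2) ^ (p-1) * 2 ^ (p-1)) := by
        rw [a1, a2, c1, c2]
    _ = _ := by ring

lemma gamma_half (k : ℕ) : Real.Gamma (k + 1 / 2) = ((2 * k).factorial : ℝ) / (4 ^ k * k.factorial) * √π := by
  induction k with
  | zero => simpa using Real.Gamma_one_half_eq
  | succ k ih =>
    have : ((k + 1 : ℕ) : ℝ) + 1 / 2 = (k + 1/2 : ℝ) + 1 := by push_cast; ring
    rw [this, Real.Gamma_add_one (by positivity), ih]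
    have : 2 * (k + 1) = (2 * k + 1) + 1 := by ring
    rw [this, Nat.factorial_succ, Nat.factorial_succ, Nat.factorial_succ, pow_succ]
    push_cast
    field_simp
    ring

lemma bessel_eq (a : ℝ) (ha : -(1/2) < a) (ξ : ℝ) (hξ : 0 < ξ) :
    besselI a ξ = (2 * π * ξ) ^ (-(1/2) : ℝ) * Real.exp ξ * (ξ ^ (a + 1/2) * JJ (a + 1/2) (a - 1/2) ξ / Real.Gamma (a + 1/2)) := by
  have hp : 0 < a + 1/2 := by linarith
  have h := R1 (a + 1/2) hp ξ
  rw [R2, R3 _ hp] at h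
  have hG := Real.Gamma_pos_of_pos hp
  have h2 := (h.mul_left ((ξ / 2) ^ a / (√π * Real.Gamma (a + 1/2)))).tsum_eq
  have e : a + 1 / 2 - 1 = a - 1/2 := by ring
  rw [e] at h2
  rw [besselI]
  convert h2 using 1
  · congr 1
    ext k
    rw [gamma_half, Real.rpow_add (by positivity)]
    have : ((ξ/2) ^ (2 * (k:ℝ))) = ξ ^ (2 * k) / 4 ^ k := by
      have : (2 * (k:ℝ)) = ((2 * k : ℕ) : ℝ) := by push_cast; ring
      rw [this, Real.rpow_natCast, div_pow, pow_mul 2]; norm_num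
    rw [this]
    have : (k:ℝ) + 1/2 + (a + 1/2) = k + a + 1 := by ring
    rw [this]
    have hG2 : 0 < Real.Gamma (k + a + 1) := Real.Gamma_pos_of_pos (by have : (0:ℝ) ≤ k := by positivity
                                                                       linarith)
    have hpi : 0 < √π := by positivity
    generalize Real.Gamma (a + 1/2) = G at *
    field_simp
  · have e1 : (2 * π * ξ) ^ (-(1/2) : ℝ) = 2 ^ (-(1/2):ℝ) * (√π)⁻¹ * ξ ^ (-(1/2):ℝ) := by
      rw [Real.mul_rpow (by positivity) hξ.le, Real.mul_rpow (by positivity) (by positivity), Real.rpow_neg pi_pos.le, Real.sqrt_eq_rpow π]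
    have e2 : (ξ / 2) ^ a = ξ ^ (-(1/2):ℝ) * ξ ^ (a + 1/2) / 2 ^ a := by
      rw [Real.div_rpow hξ.le (by norm_num), ← Real.rpow_add hξ]; ring_nf
    have e3 : (2:ℝ) ^ (a - 1/2) = 2 ^ a * 2 ^ (-(1/2):ℝ) := by
      rw [← Real.rpow_add (by norm_num)]; ring_nf
    rw [e1, e2, e3]
    have : 0 < (2:ℝ) ^ a := by positivity
    field_simp

lemma JJ_deriv (p β : ℝ) (hp : 0 < p) (hβ : -1 < β) (ξ : ℝ) :
    HasDerivAt (JJ p β) (-(JJ (p + 1) β ξ)) ξ := by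
  have key := (hasDerivAt_integral_of_dominated_loc_of_deriv_le (μ := volume.restrict (Set.Ioo (0:ℝ) 2))
    (F := fun x v => Real.exp (-(x * v)) * (v ^ (p - 1) * (1 - v / 2) ^ β))
    (F' := fun x v => (Real.exp (-(x * v)) * (-v)) * (v ^ (p - 1) * (1 - v / 2) ^ β))
    (bound := fun v => Real.exp (2 * (|ξ| + 1)) * 2 * (v ^ (p - 1) * (1 - v / 2) ^ β))
    (x₀ := ξ) (s := Metric.ball ξ 1) (Metric.ball_mem_nhds ξ one_pos) ?_ ?_ ?_ ?_ ?_ ?_).2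
  · have e : -(JJ (p + 1) β ξ) = ∫ v in Set.Ioo (0:ℝ) 2,
        (Real.exp (-(ξ * v)) * (-v)) * (v ^ (p - 1) * (1 - v / 2) ^ β) := by
      rw [JJ, ← integral_neg]
      refine setIntegral_congr_fun measurableSet_Ioo ?_
      intro v hv
      have : v ^ (p + 1 - 1) = v * v ^ (p - 1) := by
        rw [← Real.rpow_one_add' hv.1.le (by linarith)]; ring_nf
      simp only
      rw [this]; ring
    rw [e]
    exact key
  · refine Filter.Eventually.of_forall fun x => ?_
    apply Measurable.aestronglyMeasurable; fun_prop
  · exact JJint p β hp hβ ξ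
  · apply Measurable.aestronglyMeasurable; fun_prop
  · refine (ae_restrict_iff' measurableSet_Ioo).2 (Filter.Eventually.of_forall fun v hv x hx => ?_)
    have h1 : 0 ≤ v ^ (p - 1) := Real.rpow_nonneg hv.1.le _
    have h2 : 0 ≤ (1 - v / 2) ^ β := Real.rpow_nonneg (by linarith [hv.2]) _
    have h3 : |x| ≤ |ξ| + 1 := by
      rw [Metric.mem_ball, Real.dist_eq] at hx
      have := abs_sub_abs_le_abs_sub x ξ
      linarith
    rw [norm_mul, norm_mul, norm_mul, Real.norm_of_nonneg h1, Real.norm_of_nonneg h2, norm_neg,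
      Real.norm_of_nonneg hv.1.le, Real.norm_of_nonneg (Real.exp_pos _).le]
    have h4 : Real.exp (-(x * v)) ≤ Real.exp (2 * (|ξ| + 1)) := by
      rw [Real.exp_le_exp]
      have := neg_abs_le x
      nlinarith [hv.1, hv.2, abs_nonneg x]
    have h5 := hv.2.le
    have h6 := hv.1.le
    gcongr
  · exact (R3int p β hp hβ).const_mul _
  · refine Filter.Eventually.of_forall fun v x hx => ?_
    have : HasDerivAt (fun x : ℝ => -(x * v)) (-v) x := by
      simpa using ((hasDerivAt_id' x).mul_const v).fun_neg
    exact this.exp.mul_const _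

lemma rpow_mul_exp_bdd (c : ℝ) (hc : 0 < c) : ∃ M > 0, ∀ u > 0, u ^ c * Real.exp (-u) ≤ M := by
  refine ⟨c ^ c, by positivity, fun u hu => ?_⟩
  have h : u / c ≤ Real.exp (u / c) := by linarith [Real.add_one_le_exp (u / c)]
  have h2 : (u / c) ^ c ≤ Real.exp (u / c) ^ c := Real.rpow_le_rpow (by positivity) h hc.le
  rw [← Real.exp_mul, div_mul_cancel₀ _ hc.ne', Real.div_rpow hu.le hc.le,
    div_le_iff₀ (by positivity)] at h2
  rw [Real.exp_neg, ← div_eq_mul_inv, div_le_iff₀ (by positivity)]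
  linarith

lemma lip_bdd (β : ℝ) : ∃ K > 0, ∀ v ∈ Set.Icc (0:ℝ) 1, |(1 - v / 2) ^ β - 1| ≤ K * v := by
  have hcont : ContinuousOn (fun v : ℝ => β * (1 - v/2) ^ (β - 1) * (-(1/2))) (Set.Icc 0 1) := by
    refine ContinuousOn.mul (ContinuousOn.mul continuousOn_const ?_) continuousOn_const
    refine ContinuousOn.rpow_const (by fun_prop) ?_
    intro v hv
    left; linarith [hv.2]
  obtain ⟨K, hK⟩ := isCompact_Icc.exists_bound_of_continuousOn hcont
  refine ⟨max K 1, by positivity, fun v hv => ?_⟩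
  have := Convex.norm_image_sub_le_of_norm_hasDerivWithin_le (f := fun v : ℝ => (1 - v/2) ^ β)
    (f' := fun v : ℝ => β * (1 - v/2) ^ (β - 1) * (-(1/2))) (C := max K 1) (s := Set.Icc 0 1) (x := 0) (y := v)
    ?_ (fun v hv => (hK v hv).trans (le_max_left _ _)) (convex_Icc _ _) (by simp) hv
  · simpa [abs_of_nonneg hv.1] using this
  · intro v hv
    have h1 : HasDerivAt (fun v : ℝ => 1 - v/2) (-(1/2)) v := by
      simpa using ((hasDerivAt_id v).div_const 2).const_sub 1
    have := (h1.rpow_const (p := β) (Or.inl (by linarith [hv.2] : 1 - v/2 ≠ 0))).hasDerivWithinAt (s := Set.Icc 0 1)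
    convert this using 1
    ring

lemma JJ_asymp (p β : ℝ) (hp : 0 < p) (hβ : -1 < β) (r : ℝ) (hr0 : 0 ≤ r) (hr1 : r ≤ 1) :
    ∃ C > 0, ∀ ξ > 0, |ξ ^ p * JJ p β ξ - Real.Gamma p| ≤ C * ξ ^ (-r) := by
  obtain ⟨K0, hK0, hlip⟩ := lip_bdd β
  obtain ⟨M, hM, hMb⟩ := rpow_mul_exp_bdd (p + r) (by linarith)
  set K := max K0 1
  have hK1 : 1 ≤ K := le_max_right _ _
  have hint1 : IntegrableOn (fun v : ℝ => (1 - v / 2) ^ β) (Set.Ioo 0 2) := by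
    simpa using R3int 1 β one_pos hβ
  set D := ∫ v in Set.Ioo (0:ℝ) 2, (1 - v / 2) ^ β
  have hD : 0 ≤ D := setIntegral_nonneg measurableSet_Ioo fun v hv =>
    Real.rpow_nonneg (by linarith [hv.2]) _
  have hG := Real.Gamma_pos_of_pos (show 0 < p + r by linarith)
  refine ⟨K * Real.Gamma (p + r) + M * D, by positivity, fun ξ hξ => ?_⟩
  have hgi : ∀ c : ℝ, 0 < c → IntegrableOn (fun v : ℝ => v ^ (c - 1) * Real.exp (-(ξ * v))) (Set.Ioi 0) := by
    intro c hc
    have := integrableOn_rpow_mul_exp_neg_mul_rpow (p := 1) (s := c - 1) (b := ξ) (by linarith) one_pos hξ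
    simpa [Real.rpow_one, neg_mul] using this
  have hgv : ∀ c : ℝ, 0 < c → ∫ v in Set.Ioi (0:ℝ), v ^ (c - 1) * Real.exp (-(ξ * v)) = ξ ^ (-c) * Real.Gamma c := by
    intro c hc
    rw [Real.integral_rpow_mul_exp_neg_mul_Ioi hc hξ, Real.rpow_neg hξ.le, one_div, Real.inv_rpow hξ.le]
  have hset : Set.Ioi (0:ℝ) ∩ Set.Iio 2 = Set.Ioo 0 2 := Set.Ioi_inter_Iio
  have hJ : JJ p β ξ = ∫ v in Set.Ioi (0:ℝ), (Set.Iio (2:ℝ)).indicator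
      (fun v => Real.exp (-(ξ * v)) * (v ^ (p - 1) * (1 - v / 2) ^ β)) v := by
    rw [setIntegral_indicator measurableSet_Iio, hset]; rfl
  have hJi : IntegrableOn ((Set.Iio (2:ℝ)).indicator
      (fun v => Real.exp (-(ξ * v)) * (v ^ (p - 1) * (1 - v / 2) ^ β))) (Set.Ioi 0) := by
    rw [IntegrableOn, integrable_indicator_iff measurableSet_Iio, IntegrableOn,
      Measure.restrict_restrict measurableSet_Iio, Set.inter_comm, hset]
    exact JJint p β hp hβ ξ
  have hDi : IntegrableOn ((Set.Iio (2:ℝ)).indicator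
      (fun v => M * ξ ^ (-(p + r)) * (1 - v / 2) ^ β)) (Set.Ioi 0) := by
    rw [IntegrableOn, integrable_indicator_iff measurableSet_Iio, IntegrableOn,
      Measure.restrict_restrict measurableSet_Iio, Set.inter_comm, hset]
    exact hint1.const_mul _
  have hD2 : ∫ v in Set.Ioi (0:ℝ), (Set.Iio (2:ℝ)).indicator
      (fun v => M * ξ ^ (-(p + r)) * (1 - v / 2) ^ β) v = M * ξ ^ (-(p + r)) * D := by
    rw [setIntegral_indicator measurableSet_Iio, hset, integral_const_mul]
  have hdiff : |JJ p β ξ - ξ ^ (-p) * Real.Gamma p| ≤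
      K * (ξ ^ (-(p + r)) * Real.Gamma (p + r)) + M * ξ ^ (-(p + r)) * D := by
    rw [hJ, ← hgv p hp, ← integral_sub hJi (hgi p hp), ← hgv (p + r) (by linarith), ← hD2,
      ← integral_const_mul, ← integral_add ((hgi (p+r) (by linarith)).const_mul K) hDi, ← Real.norm_eq_abs]
    refine norm_integral_le_of_norm_le (((hgi (p+r) (by linarith)).const_mul K).add hDi) ?_
    refine (ae_restrict_iff' measurableSet_Ioi).2 (Filter.Eventually.of_forall fun v hv => ?_)
    have hv0 : 0 < v := hv
    have e1 : v ^ (p + r - 1) = v ^ (p - 1) * v ^ r := by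
      rw [← Real.rpow_add hv0]; ring_nf
    have h1 : 0 < v ^ (p - 1) := Real.rpow_pos_of_pos hv0 _
    have h2 : 0 < v ^ r := Real.rpow_pos_of_pos hv0 _
    have h3 := Real.exp_pos (-(ξ * v))
    rw [Real.norm_eq_abs, e1]
    have hge : 1 ≤ v → v ^ (p-1) * Real.exp (-(ξ * v)) ≤ K * (v ^ (p - 1) * v ^ r * Real.exp (-(ξ * v))) := by
      intro h
      have : 1 ≤ v ^ r := Real.one_le_rpow h hr0
      have : 1 ≤ K * v ^ r := by nlinarith
      have h4 : 0 < v ^ (p-1) * Real.exp (-(ξ * v)) := by positivity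
      nlinarith
    rcases lt_or_ge v 2 with h | h
    · rw [Set.indicator_of_mem (by exact h), Set.indicator_of_mem (by exact h)]
      have h4 : 0 ≤ (1 - v / 2) ^ β := Real.rpow_nonneg (by linarith) _
      have h5 : 0 < ξ ^ (-(p + r)) := Real.rpow_pos_of_pos hξ _
      rcases le_or_gt v 1 with hv1 | hv1
      · have e2 : Real.exp (-(ξ * v)) * (v ^ (p - 1) * (1 - v / 2) ^ β) - v ^ (p - 1) * Real.exp (-(ξ * v))
          = v ^ (p - 1) * Real.exp (-(ξ * v)) * ((1 - v / 2) ^ β - 1) := by ring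
        rw [e2, abs_mul, abs_of_pos (by positivity)]
        have h6 := hlip v ⟨hv0.le, hv1⟩
        have h7 : v ≤ v ^ r := by
          have := Real.rpow_le_rpow_of_exponent_ge hv0 hv1 hr1
          simpa using this
        have h8 : |(1 - v / 2) ^ β - 1| ≤ K * v ^ r := by
          refine h6.trans ?_
          have : K0 ≤ K := le_max_left _ _
          gcongr
        calc _ ≤ v ^ (p - 1) * Real.exp (-(ξ * v)) * (K * v ^ r) := by gcongr
          _ = K * (v ^ (p - 1) * v ^ r * Real.exp (-(ξ * v))) := by ring
          _ ≤ _ := by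
            have : 0 ≤ M * ξ ^ (-(p + r)) * (1 - v / 2) ^ β := by positivity
            linarith
      · have h6 := hMb (ξ * v) (by positivity)
        have h7 : v ^ (p - 1) * Real.exp (-(ξ * v)) ≤ M * ξ ^ (-(p + r)) := by
          rw [Real.mul_rpow hξ.le hv0.le] at h6
          have h8 : v ^ (p - 1) ≤ v ^ (p + r) := Real.rpow_le_rpow_of_exponent_le hv1.le (by linarith)
          rw [Real.rpow_neg hξ.le, ← div_eq_mul_inv, le_div_iff₀ (by positivity)]
          calc _ ≤ v ^ (p + r) * Real.exp (-(ξ * v)) * ξ ^ (p + r) := by gcongr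
            _ = _ := by ring
            _ ≤ _ := h6
        have h8 := hge hv1.le
        have h9 : Real.exp (-(ξ * v)) * (v ^ (p - 1) * (1 - v / 2) ^ β) ≤ M * ξ ^ (-(p + r)) * (1 - v / 2) ^ β := by
          calc _ = v ^ (p - 1) * Real.exp (-(ξ * v)) * (1 - v / 2) ^ β := by ring
            _ ≤ _ := by gcongr
        have h10 : 0 ≤ Real.exp (-(ξ * v)) * (v ^ (p - 1) * (1 - v / 2) ^ β) := by positivity
        have h11 : 0 ≤ v ^ (p-1) * Real.exp (-(ξ * v)) := by positivity
        rw [abs_le]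
        constructor <;> linarith
    · rw [Set.indicator_of_notMem (by simpa using h), Set.indicator_of_notMem (by simpa using h), zero_sub, abs_neg,
        abs_of_pos (by positivity), add_zero]
      exact hge (by linarith)
  have e : ξ ^ p * JJ p β ξ - Real.Gamma p = ξ ^ p * (JJ p β ξ - ξ ^ (-p) * Real.Gamma p) := by
    have : ξ ^ p * ξ ^ (-p) = 1 := by rw [← Real.rpow_add hξ]; simp
    linear_combination Real.Gamma p * this
  have e2 : ξ ^ (-r) = ξ ^ p * ξ ^ (-(p + r)) := by
    rw [← Real.rpow_add hξ]; ring_nf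
  have hpos : 0 < ξ ^ p := Real.rpow_pos_of_pos hξ _
  rw [e, abs_mul, abs_of_pos hpos, e2]
  calc _ ≤ ξ ^ p * (K * (ξ ^ (-(p + r)) * Real.Gamma (p + r)) + M * ξ ^ (-(p + r)) * D) := by gcongr
    _ = _ := by ring

/-- the exponent -/
noncomputable def EE (s y z : ℝ) : ℝ :=
  -((y ^ 2 + z ^ 2) * Real.cosh s - 2 * (y * z)) / (2 * Real.sinh s)

/-- the Mehler kernel in hyperbolic form -/
noncomputable def WW (s y z : ℝ) : ℝ :=
  (2 * π * Real.sinh s) ^ (-(1/2) : ℝ) * Real.exp (EE s y z)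

/-- the normalized Laplace integral -/
noncomputable def QQ (a ξ : ℝ) : ℝ :=
  ξ ^ (a + 1/2) * JJ (a + 1/2) (a - 1/2) ξ / Real.Gamma (a + 1/2)

lemma exp_facts (s : ℝ) (hs : 0 < s) :
    0 < Real.sinh s ∧ 1 - Real.exp (-2 * s) = 2 * Real.exp (-s) * Real.sinh s ∧
     1 + Real.exp (-2 * s) = 2 * Real.exp (-s) * Real.cosh s := by
  refine ⟨Real.sinh_pos_iff.2 hs, ?_, ?_⟩
  · rw [Real.sinh_eq, show -2 * s = -s + -s by ring, Real.exp_add]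
    have : Real.exp (-s) * Real.exp s = 1 := by rw [← Real.exp_add]; simp
    linear_combination -this
  · rw [Real.cosh_eq, show -2 * s = -s + -s by ring, Real.exp_add]
    have : Real.exp (-s) * Real.exp s = 1 := by rw [← Real.exp_add]; simp
    linear_combination -this

lemma hermite_eq (s y z : ℝ) (hs : 0 < s) : hermiteHeatKernel s y z = WW s y z := by
  obtain ⟨hS, e1, e2⟩ := exp_facts s hs
  have hE := Real.exp_pos (-s)
  rw [hermiteHeatKernel, WW]
  congr 1
  · rw [e1]
    have : Real.exp (-s) / (2 * Real.exp (-s) * Real.sinh s) = (2 * Real.sinh s)⁻¹ := by field_simp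
    rw [this, Real.inv_rpow (by positivity), ← Real.rpow_neg (by positivity),
      show -(1:ℝ)/2 = -(1/2) by ring, ← Real.mul_rpow (by positivity) (by positivity)]
    ring_nf
  · congr 1
    rw [e1, EE]
    have e3 : Real.exp (-s) ^ 2 = 2 * Real.exp (-s) * Real.cosh s - 1 := by
      rw [← e2, ← Real.exp_nat_mul]; push_cast; ring_nf
    have : ((y - Real.exp (-s) * z) ^ 2 + (z - Real.exp (-s) * y) ^ 2) =
       2 * Real.exp (-s) * ((y ^ 2 + z ^ 2) * Real.cosh s - 2 * (y * z)) := by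
      linear_combination (y^2 + z^2) * e3
    rw [this]
    field_simp

lemma laguerre_eq (a : ℝ) (ha : -(1/2) < a) (s y z : ℝ) (hs : 0 < s) (hy : 0 < y) (hz : 0 < z) :
    laguerreHeatKernel a s y z = WW s y z * QQ a (y * z / Real.sinh s) := by
  obtain ⟨hS, e1, e2⟩ := exp_facts s hs
  have hE := Real.exp_pos (-s)
  rw [laguerreHeatKernel, WW, e1, e2]
  have f1 : 2 * Real.exp (-s) / (2 * Real.exp (-s) * Real.sinh s) = (Real.sinh s)⁻¹ := by field_simp
  have f2 : 2 * y * z * Real.exp (-s) / (2 * Real.exp (-s) * Real.sinh s) = y * z / Real.sinh s := by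
    field_simp
  rw [f1, f2, bessel_eq a ha _ (by positivity), QQ]
  have f3 : Real.exp (EE s y z) = Real.exp (y * z / Real.sinh s) *
     Real.exp (-(1 / 2) * (y ^ 2 + z ^ 2) * (2 * Real.exp (-s) * Real.cosh s) / (2 * Real.exp (-s) * Real.sinh s)) := by
    rw [← Real.exp_add, EE]
    congr 1
    field_simp
    ring
  have f4 : (2 * π * Real.sinh s) ^ (-(1/2) : ℝ) = (Real.sinh s)⁻¹ ^ ((1:ℝ)/2) *
      (y * z / Real.sinh s) ^ ((1:ℝ)/2) * (2 * π * (y * z / Real.sinh s)) ^ (-(1/2) : ℝ) := by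
    set ξ := y * z / Real.sinh s
    have hξ : 0 < ξ := by positivity
    rw [Real.mul_rpow (y := ξ) (by positivity) hξ.le, Real.mul_rpow (y := Real.sinh s) (by positivity) hS.le,
      Real.inv_rpow hS.le, ← Real.rpow_neg hS.le]
    have : ξ ^ ((1:ℝ)/2) * ξ ^ (-(1/2) : ℝ) = 1 := by rw [← Real.rpow_add hξ]; simp
    linear_combination (-(2 * π) ^ (-(1/2) : ℝ) * (Real.sinh s) ^ (-(1/2) : ℝ)) * this
  rw [f3, f4]
  ring

lemma EE_deriv (s y z : ℝ) (hs : 0 < s) :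
    HasDerivAt (fun s => EE s y z) (((y^2 + z^2) - 2 * (y * z) * Real.cosh s) / (2 * Real.sinh s ^ 2)) s := by
  have hS := Real.sinh_pos_iff.2 hs
  have h1 : HasDerivAt (fun s => -((y ^ 2 + z ^ 2) * Real.cosh s - 2 * (y * z))) (-((y^2+z^2) * Real.sinh s)) s :=
    (((Real.hasDerivAt_cosh s).const_mul (y^2+z^2)).sub_const _).fun_neg
  have h2 : HasDerivAt (fun s => 2 * Real.sinh s) (2 * Real.cosh s) s := (Real.hasDerivAt_sinh s).const_mul 2
  have h3 := h1.fun_div h2 (by positivity)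
  refine h3.congr_deriv ?_
  have := Real.cosh_sq s
  field_simp
  linear_combination (y^2+z^2) * this

lemma WW_deriv (s y z : ℝ) (hs : 0 < s) :
    HasDerivAt (fun s => WW s y z) (WW s y z * (-(1/2) * (Real.cosh s / Real.sinh s) + 
      ((y^2 + z^2) - 2 * (y * z) * Real.cosh s) / (2 * Real.sinh s ^ 2))) s := by
  have hS := Real.sinh_pos_iff.2 hs
  have h1 : HasDerivAt (fun s => 2 * π * Real.sinh s) (2 * π * Real.cosh s) s :=
    (Real.hasDerivAt_sinh s).const_mul _
  have h2 := h1.rpow_const (p := -(1/2)) (Or.inl (by positivity))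
  have h3 := h2.fun_mul (EE_deriv s y z hs).exp
  refine h3.congr_deriv ?_
  rw [WW, Real.rpow_sub_one (by positivity)]
  field_simp

lemma QQ_deriv (a : ℝ) (ha : -(1/2) < a) (ξ : ℝ) (hξ : 0 < ξ) :
    HasDerivAt (QQ a) (((a + 1/2) * (ξ ^ (a + 1/2) * JJ (a + 1/2) (a - 1/2) ξ) -
      ξ ^ (a + 1/2 + 1) * JJ (a + 1/2 + 1) (a - 1/2) ξ) / Real.Gamma (a + 1/2) / ξ) ξ := by
  have h1 := JJ_deriv (a + 1/2) (a - 1/2) (by linarith) (by linarith) ξ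
  have h2 := Real.hasDerivAt_rpow_const (p := a + 1/2) (Or.inl hξ.ne')
  have h3 := (h2.fun_mul h1).div_const (Real.Gamma (a + 1/2))
  refine h3.congr_deriv ?_
  have hG : Real.Gamma (a + 1/2) ≠ 0 := (Real.Gamma_pos_of_pos (by linarith)).ne'
  rw [Real.rpow_sub_one hξ.ne', Real.rpow_add_one hξ.ne']
  generalize Real.Gamma (a + 1/2) = G at *
  field_simp
  ring

lemma diff_deriv (a : ℝ) (ha : -(1/2) < a) (s y z : ℝ) (hs : 0 < s) (hy : 0 < y) (hz : 0 < z) :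
    deriv (fun s => laguerreHeatKernel a s y z) s - deriv (fun s => hermiteHeatKernel s y z) s =
    WW s y z * ((-(1/2) * (Real.cosh s / Real.sinh s) + 
      ((y^2 + z^2) - 2 * (y * z) * Real.cosh s) / (2 * Real.sinh s ^ 2)) * (QQ a (y * z / Real.sinh s) - 1)
      - (Real.cosh s / Real.sinh s) * (((a + 1/2) * ((y * z / Real.sinh s) ^ (a + 1/2) * JJ (a + 1/2) (a - 1/2) (y * z / Real.sinh s)) -
      (y * z / Real.sinh s) ^ (a + 1/2 + 1) * JJ (a + 1/2 + 1) (a - 1/2) (y * z / Real.sinh s)) / Real.Gamma (a + 1/2))) := by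
  have hS := Real.sinh_pos_iff.2 hs
  have hnh : (fun s => hermiteHeatKernel s y z) =ᶠ[nhds s] fun s => WW s y z := by
    filter_upwards [lt_mem_nhds hs] with s hs using hermite_eq s y z hs
  have hnl : (fun s => laguerreHeatKernel a s y z) =ᶠ[nhds s] fun s => WW s y z * QQ a (y * z / Real.sinh s) := by
    filter_upwards [lt_mem_nhds hs] with s hs using laguerre_eq a ha s y z hs hy hz
  rw [hnh.deriv_eq, hnl.deriv_eq, (WW_deriv s y z hs).deriv]
  have hξ : HasDerivAt (fun s => y * z / Real.sinh s) (-(y * z / Real.sinh s * (Real.cosh s / Real.sinh s))) s := by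
    have := (hasDerivAt_const s (y * z)).fun_div (Real.hasDerivAt_sinh s) hS.ne'
    refine this.congr_deriv ?_
    field_simp
    ring
  have hpos : 0 < y * z / Real.sinh s := by positivity
  have hq := (QQ_deriv a ha _ hpos).comp s hξ
  have h := (WW_deriv s y z hs).fun_mul hq
  rw [HasDerivAt.deriv (f := fun s => WW s y z * QQ a (y * z / Real.sinh s)) h]
  simp only [Function.comp]
  set ξ := y * z / Real.sinh s
  generalize ((a + 1/2) * (ξ ^ (a + 1/2) * JJ (a + 1/2) (a - 1/2) ξ) -
      ξ ^ (a + 1/2 + 1) * JJ (a + 1/2 + 1) (a - 1/2) ξ) / Real.Gamma (a + 1/2) = T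
  have : T / ξ * ξ = T := div_mul_cancel₀ _ hpos.ne'
  linear_combination (-(WW s y z) * (Real.cosh s / Real.sinh s)) * this

lemma g_bounds (a : ℝ) (ha : -(1/2) < a) (r : ℝ) (hr0 : 0 ≤ r) (hr1 : r ≤ 1) :
    ∃ K > 0, ∀ ξ > 0, |QQ a ξ - 1| ≤ K * ξ ^ (-r) ∧ 
     |((a + 1/2) * (ξ ^ (a + 1/2) * JJ (a + 1/2) (a - 1/2) ξ) -
      ξ ^ (a + 1/2 + 1) * JJ (a + 1/2 + 1) (a - 1/2) ξ) / Real.Gamma (a + 1/2)| ≤ K * ξ ^ (-r) := by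
  have hp : 0 < a + 1/2 := by linarith
  obtain ⟨C1, hC1, h1⟩ := JJ_asymp (a + 1/2) (a - 1/2) hp (by linarith) r hr0 hr1
  obtain ⟨C2, hC2, h2⟩ := JJ_asymp (a + 1/2 + 1) (a - 1/2) (by linarith) (by linarith) r hr0 hr1
  have hG := Real.Gamma_pos_of_pos hp
  rw [Real.Gamma_add_one hp.ne'] at h2
  set p := a + 1/2
  set G := Real.Gamma p
  refine ⟨C1 / G + (p * C1 + C2) / G, by positivity, fun ξ hξ => ?_⟩
  have hr : 0 < ξ ^ (-r) := Real.rpow_pos_of_pos hξ _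
  have a1 := h1 ξ hξ
  have a2 := h2 ξ hξ
  set X := ξ ^ p * JJ p (a - 1/2) ξ
  set Y := ξ ^ (p + 1) * JJ (p + 1) (a - 1/2) ξ
  constructor
  · have : QQ a ξ - 1 = (X - G) / G := by
      rw [sub_div, div_self hG.ne']; rfl
    rw [this, abs_div, abs_of_pos hG]
    calc _ ≤ (C1 * ξ ^ (-r)) / G := by gcongr
      _ = C1 / G * ξ ^ (-r) := by ring
      _ ≤ _ := by
        have : 0 ≤ (p * C1 + C2) / G * ξ ^ (-r) := by positivity
        nlinarith
  · have : (p * X - Y) / G = (p * (X - G) - (Y - p * G)) / G := by ring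
    rw [this, abs_div, abs_of_pos hG]
    have : |p * (X - G) - (Y - p * G)| ≤ p * (C1 * ξ ^ (-r)) + C2 * ξ ^ (-r) := by
      refine (abs_sub _ _).trans ?_
      rw [abs_mul, abs_of_pos hp]
      gcongr
    calc _ ≤ (p * (C1 * ξ ^ (-r)) + C2 * ξ ^ (-r)) / G := by gcongr
      _ = (p * C1 + C2) / G * ξ ^ (-r) := by ring
      _ ≤ _ := by
        have : 0 ≤ C1 / G * ξ ^ (-r) := by positivity
        nlinarith

lemma N2 (s : ℝ) (hs : 0 < s) : (2 * π * Real.sinh s) ^ (-(1/2) : ℝ) * (1 + s) ≤ 4 / √s := by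
  have hS := Real.sinh_pos_iff.2 hs
  rw [Real.rpow_neg (by positivity), ← Real.sqrt_eq_rpow, inv_mul_eq_div, div_le_div_iff₀ (by positivity) (by positivity)]
  refine abs_le_of_sq_le_sq' ?_ (by positivity) |>.2
  rw [mul_pow, mul_pow, Real.sq_sqrt hs.le, Real.sq_sqrt (by positivity)]
  have h3 : s + 4 * s^3/27 ≤ Real.sinh s := by
    have h := Real.sinh_three_mul (s/3)
    rw [show 3 * (s/3) = s by ring] at h
    have h1 : s/3 ≤ Real.sinh (s/3) := Real.self_le_sinh_iff.2 (by positivity)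
    have h2 : (s/3)^3 ≤ Real.sinh (s/3)^3 := pow_le_pow_left₀ (by positivity) h1 3
    rw [h]
    nlinarith
  have hpi := Real.pi_gt_three
  have : 0 < s^3 := by positivity
  have : 6 * Real.sinh s ≤ 2 * π * Real.sinh s := by nlinarith
  nlinarith [mul_pos hs hs, mul_nonneg hs.le (sq_nonneg (s - 1))]

lemma N1 (s y z K m g g2 : ℝ) (hs : 0 < s) (hy : 0 < y) (hz : 0 < z) (hK : 0 < K) (hm : 0 ≤ m)
    (hg : |g| ≤ K * m) (hg2 : |g2| ≤ K * m) :
    |s * (WW s y z * ((-(1/2) * (Real.cosh s / Real.sinh s) + 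
      ((y^2 + z^2) - 2 * (y * z) * Real.cosh s) / (2 * Real.sinh s ^ 2)) * g
      - (Real.cosh s / Real.sinh s) * g2))| ≤ 16 * K * m / √s * 
        Real.exp (-(y * z * (Real.cosh s - 1) / (2 * Real.sinh s))) := by
  have hS := Real.sinh_pos_iff.2 hs
  have hsS : s ≤ Real.sinh s := Real.self_le_sinh_iff.2 hs.le
  have hc : 1 ≤ Real.cosh s := Real.one_le_cosh s
  have hcS : Real.cosh s - Real.sinh s = Real.exp (-s) := Real.cosh_sub_sinh s
  have he1 : Real.exp (-s) ≤ 1 := Real.exp_le_one_iff.2 (by linarith)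
  have hN := N2 s hs
  have hsc : s * (Real.cosh s / Real.sinh s) ≤ 1 + s := by
    rw [← mul_div_assoc, div_le_iff₀ hS]
    nlinarith
  have hsc0 : 0 ≤ s * (Real.cosh s / Real.sinh s) := by positivity
  have hE1 : |s * (((y^2 + z^2) - 2 * (y * z) * Real.cosh s) / (2 * Real.sinh s ^ 2))| ≤ - EE s y z := by
    have hyz : 0 ≤ (y - z)^2 := sq_nonneg _
    have b1 : |(y^2 + z^2) - 2 * (y * z) * Real.cosh s| ≤ (y ^ 2 + z ^ 2) * Real.cosh s - 2 * (y * z) := by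
      have : 0 < y * z := by positivity
      have h4 : 0 ≤ (y^2+z^2) := by positivity
      rw [abs_le]
      constructor <;> nlinarith
    have e : -EE s y z = ((y ^ 2 + z ^ 2) * Real.cosh s - 2 * (y * z)) / (2 * Real.sinh s) := by
      rw [EE]; ring
    rw [e, abs_mul, abs_div, abs_of_pos hs, abs_of_pos (a := 2 * Real.sinh s ^ 2) (by positivity)]
    have b0 := abs_nonneg ((y^2 + z^2) - 2 * (y * z) * Real.cosh s)
    rw [← mul_div_assoc, div_le_div_iff₀ (by positivity) (by positivity)]
    calc _ ≤ Real.sinh s * ((y ^ 2 + z ^ 2) * Real.cosh s - 2 * (y * z)) * (2 * Real.sinh s) := by gcongr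
      _ = _ := by ring
  have hE2 : y * z * (Real.cosh s - 1) / Real.sinh s ≤ -EE s y z := by
    have e : -EE s y z = ((y ^ 2 + z ^ 2) * Real.cosh s - 2 * (y * z)) / (2 * Real.sinh s) := by
      rw [EE]; ring
    rw [e, div_le_div_iff₀ (by positivity) (by positivity)]
    have : y * z * (Real.cosh s - 1) * 2 ≤ ((y ^ 2 + z ^ 2) * Real.cosh s - 2 * (y * z)) := by
      nlinarith [sq_nonneg (y - z)]
    nlinarith
  set N := (2 * π * Real.sinh s) ^ (-(1/2) : ℝ) with hNdef
  have hN0 : 0 < N := by positivity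
  have hWW : WW s y z = N * Real.exp (EE s y z) := rfl
  set E := EE s y z
  set A := s * (((y^2 + z^2) - 2 * (y * z) * Real.cosh s) / (2 * Real.sinh s ^ 2))
  set c := s * (Real.cosh s / Real.sinh s)
  have e0 : s * (WW s y z * ((-(1/2) * (Real.cosh s / Real.sinh s) + 
      ((y^2 + z^2) - 2 * (y * z) * Real.cosh s) / (2 * Real.sinh s ^ 2)) * g
      - (Real.cosh s / Real.sinh s) * g2)) = N * Real.exp E * ((-(1/2) * c + A) * g - c * g2) := by
    rw [hWW]; simp only [A, c]; ring
  rw [e0, abs_mul, abs_of_pos (by positivity)]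
  have hKm : 0 ≤ K * m := by positivity
  have b1 : |(-(1/2) * c + A) * g - c * g2| ≤ (3/2 * (1 + s) + (-E)) * (K * m) := by
    have c1 : |-(1/2) * c + A| ≤ 1/2 * (1 + s) + (-E) := by
      rw [abs_le] at hE1 ⊢
      constructor <;> linarith [hE1.1, hE1.2]
    have c2 : |c| ≤ 1 + s := by rw [abs_of_nonneg hsc0]; exact hsc
    refine (abs_sub _ _).trans ?_
    rw [abs_mul, abs_mul]
    calc _ ≤ (1/2 * (1 + s) + (-E)) * (K * m) + (1 + s) * (K * m) := by
            have := (abs_nonneg _).trans c1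
            gcongr
      _ = _ := by ring
  have b2 : Real.exp E * (3/2 * (1 + s) + (-E)) ≤ Real.exp (E/2) * (4 * (1 + s)) := by
    have c1 : Real.exp E = Real.exp (E/2) * Real.exp (E/2) := by rw [← Real.exp_add]; ring_nf
    have c2 := Real.add_one_le_exp (-(E/2))
    have c3 : Real.exp (E/2) * Real.exp (-(E/2)) = 1 := by rw [← Real.exp_add]; simp
    have c4 := Real.exp_pos (E/2)
    have c5 : Real.exp (E/2) * (-(E/2)) ≤ 1 := by nlinarith
    have hE0 : E ≤ 0 := by linarith [(abs_nonneg _).trans hE1]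
    have c6 : Real.exp (E/2) ≤ 1 := Real.exp_le_one_iff.2 (by linarith)
    rw [c1, mul_assoc]
    refine mul_le_mul_of_nonneg_left ?_ c4.le
    nlinarith
  have b3 : Real.exp (E/2) ≤ Real.exp (-(y * z * (Real.cosh s - 1) / (2 * Real.sinh s))) := by
    rw [Real.exp_le_exp]
    have : y * z * (Real.cosh s - 1) / (2 * Real.sinh s) = y * z * (Real.cosh s - 1) / Real.sinh s / 2 := by
      field_simp
    rw [this]; linarith
  calc N * Real.exp E * |(-(1/2) * c + A) * g - c * g2| 
      ≤ N * Real.exp E * ((3/2 * (1 + s) + (-E)) * (K * m)) := by gcongr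
    _ = N * (Real.exp E * (3/2 * (1 + s) + (-E))) * (K * m) := by ring
    _ ≤ N * (Real.exp (E/2) * (4 * (1 + s))) * (K * m) := by gcongr
    _ = 4 * (N * (1 + s)) * (K * m) * Real.exp (E/2) := by ring
    _ ≤ 4 * (4 / √s) * (K * m) * Real.exp (-(y * z * (Real.cosh s - 1) / (2 * Real.sinh s))) := by gcongr
    _ = _ := by ring

lemma pointwise (a : ℝ) (ha : -(1/2) < a) : ∃ C > 0, ∀ t y z : ℝ, 0 < t → 0 < y → 0 < z →
    |t^2 * (deriv (fun s => laguerreHeatKernel a s y z) (t^2) -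
      deriv (fun s => hermiteHeatKernel s y z) (t^2))| ≤ C / t ∧
    |t^2 * (deriv (fun s => laguerreHeatKernel a s y z) (t^2) -
      deriv (fun s => hermiteHeatKernel s y z) (t^2))| ≤ C * t / (y * z) := by
  obtain ⟨K1, hK1, h1⟩ := g_bounds a ha 0 le_rfl zero_le_one
  obtain ⟨K2, hK2, h2⟩ := g_bounds a ha 1 zero_le_one le_rfl
  refine ⟨128 * K1 + 32 * K2, by positivity, fun t y z ht hy hz => ?_⟩
  have hs : 0 < t^2 := by positivity
  have hS := Real.sinh_pos_iff.2 hs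
  rw [diff_deriv a ha (t^2) y z hs hy hz]
  have hst : √(t^2) = t := Real.sqrt_sq ht.le
  have hξ : 0 < y * z / Real.sinh (t^2) := by positivity
  obtain ⟨p1, p2⟩ := h1 _ hξ
  obtain ⟨q1, q2⟩ := h2 _ hξ
  rw [neg_zero, Real.rpow_zero] at p1 p2
  have B1 := N1 (t^2) y z K1 1 _ _ hs hy hz hK1 zero_le_one p1 p2
  have B2 := N1 (t^2) y z K2 _ _ _ hs hy hz hK2 (by positivity) q1 q2
  have hc : 1 ≤ Real.cosh (t^2) := Real.one_le_cosh _
  rw [hst] at B1 B2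
  set B := y * z * (Real.cosh (t^2) - 1) / (2 * Real.sinh (t^2)) with hB
  have hB0 : 0 ≤ B := by
    have : 0 ≤ Real.cosh (t^2) - 1 := by linarith
    positivity
  have hexp : Real.exp (-B) ≤ 1 := Real.exp_le_one_iff.2 (by linarith)
  constructor
  · refine B1.trans ?_
    calc _ ≤ 16 * K1 * 1 / t * 1 := by gcongr
      _ ≤ _ := by
        rw [mul_one, mul_one]
        gcongr
        linarith
  · rcases le_or_gt (t^2) 1 with h | h
    · refine B2.trans ?_
      rw [Real.rpow_neg_one, inv_div]
      have hS2 : Real.sinh (t^2) ≤ 2 * t^2 := by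
        rw [Real.sinh_eq]
        have k1 := Real.abs_exp_sub_one_sub_id_le (x := t^2) (by rw [abs_of_pos hs]; exact h)
        have k2 := Real.add_one_le_exp (-t^2)
        have k3 := (abs_le.1 k1).2
        nlinarith
      calc _ ≤ 16 * K2 * (2 * t^2 / (y * z)) / t * 1 := by gcongr
        _ = 32 * K2 * t / (y * z) := by field_simp; ring
        _ ≤ _ := by gcongr; linarith
    · refine B1.trans ?_
      have hcs : Real.sinh (t^2) / 4 ≤ Real.cosh (t^2) - 1 := by
        rw [Real.sinh_eq, Real.cosh_eq]
        have k1 : Real.exp 1 ≤ Real.exp (t^2) := Real.exp_le_exp.2 h.le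
        have k2 := Real.exp_one_gt_d9
        have k3 := Real.exp_pos (-t^2)
        linarith
      have hBl : y * z / 8 ≤ B := by
        rw [hB, div_le_div_iff₀ (by norm_num) (by positivity)]
        have : 0 < y * z := by positivity
        nlinarith
      have hexp2 : Real.exp (-B) ≤ 8 / (y * z) := by
        have hyz : 0 < y * z := by positivity
        have hBp : 0 < B := by linarith [show 0 < y * z / 8 by positivity]
        rw [Real.exp_neg, inv_eq_one_div, div_le_div_iff₀ (by positivity) hyz]
        have := Real.add_one_le_exp B
        linarith
      have ht1 : 1 / t ≤ t := by
        rw [div_le_iff₀ ht]; nlinarith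
      calc _ = 16 * K1 * (1 / t) * Real.exp (-B) := by ring
        _ ≤ 16 * K1 * t * (8 / (y * z)) := by gcongr
        _ = 128 * K1 * t / (y * z) := by ring
        _ ≤ _ := by gcongr; linarith

lemma intbound (q C x : ℝ) (hq : 2 ≤ q) (hC : 0 < C) (hx : 0 < x) (f : ℝ × ℝ → ℝ)
    (hf : ∀ p : ℝ × ℝ, 0 < p.1 → 0 < p.2 → |p.1 - x| < p.2 →
      |f p| ≤ if p.2 ≤ x / 2 then (4 * C * p.2 / x ^ 2) ^ q / p.2 ^ 2 else (C / p.2) ^ q / p.2 ^ 2) :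
    ∫ p in {p : ℝ × ℝ | 0 < p.1 ∧ 0 < p.2 ∧ |p.1 - x| < p.2}, f p ≤ 4 * (2 * C / x) ^ q := by
  set Γ : Set (ℝ × ℝ) := {p : ℝ × ℝ | 0 < p.1 ∧ 0 < p.2 ∧ |p.1 - x| < p.2} with hΓ
  have hΓm : MeasurableSet Γ := by
    refine ((measurableSet_lt measurable_const measurable_fst).inter
      ((measurableSet_lt measurable_const measurable_snd).inter
      (measurableSet_lt ?_ measurable_snd)))
    fun_prop
  set h : ℝ → ℝ := fun t => if t ≤ x / 2 then (4 * C * t / x ^ 2) ^ q / t ^ 2 else (C / t) ^ q / t ^ 2 with hh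
  have hhm : Measurable h := by
    refine Measurable.ite measurableSet_Iic ?_ ?_ <;> fun_prop
  set G : ℝ × ℝ → ENNReal := fun p => if 0 < p.2 ∧ |p.1 - x| < p.2 then ENNReal.ofReal (h p.2) else 0 with hG
  have hGm : Measurable G := by
    refine Measurable.ite ?_ (by fun_prop) measurable_const
    refine ((measurableSet_lt measurable_const measurable_snd).inter
      (measurableSet_lt ?_ measurable_snd))
    fun_prop
  have i1 : IntegrableOn (fun t : ℝ => 2 * (4 * C / x ^ 2) ^ q * t ^ (q - 1)) (Set.Ioc 0 (x/2)) := by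
    rw [← intervalIntegrable_iff_integrableOn_Ioc_of_le (by positivity)]
    exact (intervalIntegral.intervalIntegrable_rpow' (by linarith)).const_mul _
  have i2 : IntegrableOn (fun t : ℝ => 2 * C ^ q * t ^ (-q - 1)) (Set.Ioi (x/2)) :=
    (integrableOn_Ioi_rpow_of_lt (by linarith) (by positivity)).const_mul _
  have hx2 : 0 < (2 * C / x) ^ q := by positivity
  have v1 : ∫ t in Set.Ioc 0 (x/2), 2 * (4 * C / x ^ 2) ^ q * t ^ (q - 1) ≤ 2 * (2 * C / x) ^ q := by
    rw [← intervalIntegral.integral_of_le (by positivity), intervalIntegral.integral_const_mul,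
      integral_rpow (Or.inl (by linarith)), sub_add_cancel, Real.zero_rpow (by linarith), sub_zero]
    have : (2 * C / x) ^ q = (4 * C / x ^ 2) ^ q * (x/2) ^ q := by
      rw [← Real.mul_rpow (by positivity) (by positivity)]
      congr 1; field_simp; ring
    rw [this, ← mul_div_assoc, div_le_iff₀ (by linarith)]
    rw [this] at hx2
    nlinarith
  have v2 : ∫ t in Set.Ioi (x/2), 2 * C ^ q * t ^ (-q - 1) ≤ 2 * (2 * C / x) ^ q := by
    rw [integral_const_mul, integral_Ioi_rpow_of_lt (by linarith) (by positivity), sub_add_cancel,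
      neg_div_neg_eq]
    have : (2 * C / x) ^ q = C ^ q * (x/2) ^ (-q) := by
      rw [Real.rpow_neg (by positivity), ← Real.inv_rpow (by positivity),
        ← Real.mul_rpow (by positivity) (by positivity)]
      congr 1; field_simp
    rw [this, ← mul_div_assoc, div_le_iff₀ (by linarith)]
    rw [this] at hx2
    nlinarith
  have hlint : ∫⁻ p in Γ, ENNReal.ofReal ‖f p‖ ≤ ENNReal.ofReal (4 * (2 * C / x) ^ q) := by
    calc _ ≤ ∫⁻ p in Γ, G p := by
          refine setLIntegral_mono hGm fun p hp => ?_
          simp only [hG]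
          rw [if_pos hp.2]
          exact ENNReal.ofReal_le_ofReal (hf p hp.1 hp.2.1 hp.2.2)
      _ ≤ ∫⁻ p, G p := setLIntegral_le_lintegral _ _
      _ = ∫⁻ t, ∫⁻ y, G (y, t) := by
          rw [Measure.volume_eq_prod, lintegral_prod_symm' _ hGm]
      _ ≤ ∫⁻ t, ((Set.Ioc 0 (x/2)).indicator (fun t => ENNReal.ofReal (2 * (4 * C / x ^ 2) ^ q * t ^ (q - 1))) t
            + (Set.Ioi (x/2)).indicator (fun t => ENNReal.ofReal (2 * C ^ q * t ^ (-q - 1))) t) := by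
          refine lintegral_mono fun t => ?_
          rcases le_or_gt t 0 with ht | ht
          · have : ∀ y, G (y, t) = 0 := by
              intro y; simp only [hG]; rw [if_neg]; intro h; linarith [h.1]
            simp [this]
          have hin : ∫⁻ y, G (y, t) = ENNReal.ofReal (h t * (2 * t)) := by
            have : (fun y => G (y, t)) = (Set.Ioo (x - t) (x + t)).indicator (fun _ => ENNReal.ofReal (h t)) := by
              ext y
              simp only [hG, Set.indicator_apply, Set.mem_Ioo, abs_lt, ht, true_and]
              congr 1
              apply propext
              constructor <;> rintro ⟨h1, h2⟩ <;> constructor <;> linarith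
            rw [this, lintegral_indicator measurableSet_Ioo, setLIntegral_const, Real.volume_Ioo,
              ← ENNReal.ofReal_mul' (by linarith)]
            ring_nf
          rw [hin]
          rcases le_or_gt t (x/2) with htx | htx
          · rw [Set.indicator_of_mem (by exact ⟨ht, htx⟩)]
            refine le_trans (le_of_eq ?_) (self_le_add_right _ _)
            congr 1
            simp only [hh, if_pos htx]
            rw [show 4 * C * t / x ^ 2 = 4 * C / x ^ 2 * t by ring, Real.mul_rpow (by positivity) ht.le,
              Real.rpow_sub_one ht.ne']
            field_simp
          · rw [Set.indicator_of_mem (s := Set.Ioi (x/2)) (by exact htx)]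
            refine le_trans (le_of_eq ?_) (self_le_add_left _ _)
            congr 1
            simp only [hh, if_neg (not_le.2 htx)]
            rw [Real.div_rpow hC.le ht.le, Real.rpow_sub_one ht.ne', Real.rpow_neg ht.le]
            field_simp
      _ = ENNReal.ofReal (∫ t in Set.Ioc 0 (x/2), 2 * (4 * C / x ^ 2) ^ q * t ^ (q - 1)) +
            ENNReal.ofReal (∫ t in Set.Ioi (x/2), 2 * C ^ q * t ^ (-q - 1)) := by
          rw [lintegral_add_left, lintegral_indicator measurableSet_Ioc, lintegral_indicator measurableSet_Ioi,
            ofReal_integral_eq_lintegral_ofReal i1, ofReal_integral_eq_lintegral_ofReal i2]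
          · refine (ae_restrict_iff' measurableSet_Ioi).2 (Filter.Eventually.of_forall fun t ht => ?_)
            have : 0 < t := lt_trans (by positivity) ht
            simp only [Pi.zero_apply]
            positivity
          · refine (ae_restrict_iff' measurableSet_Ioc).2 (Filter.Eventually.of_forall fun t ht => ?_)
            have : 0 < t := ht.1
            simp only [Pi.zero_apply]
            positivity
          · exact Measurable.indicator (by fun_prop) measurableSet_Ioc
      _ ≤ ENNReal.ofReal (2 * (2 * C / x) ^ q) + ENNReal.ofReal (2 * (2 * C / x) ^ q) := by
          gcongr
      _ = _ := by
          rw [← ENNReal.ofReal_add (by positivity) (by positivity)]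
          ring_nf
  refine (le_abs_self _).trans ?_
  rw [← Real.norm_eq_abs]
  refine (norm_integral_le_lintegral_norm _).trans ?_
  exact ENNReal.toReal_le_of_le_ofReal (by positivity) hlint

theorem stmt17 (q : ℝ) (hq : 2 ≤ q) (a : ℝ) (ha : -(1 / 2) < a) :
    ∃ C > 0, ∀ x z : ℝ, 0 < x → x / 2 < z → z < 2 * x →
      (∫ p in {p : ℝ × ℝ | 0 < p.1 ∧ 0 < p.2 ∧ |p.1 - x| < p.2},
          |p.2 ^ 2 * (deriv (fun s => laguerreHeatKernel a s p.1 z) (p.2 ^ 2) -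
              deriv (fun s => hermiteHeatKernel s p.1 z) (p.2 ^ 2))| ^ q / p.2 ^ 2) ^ (1 / q) ≤
        C / z * (1 + Real.sqrt (z / |z - x|)) := by
  obtain ⟨C, hC, hb⟩ := pointwise a ha
  refine ⟨16 * C, by positivity, fun x z hx hxz hzx => ?_⟩
  have hz : 0 < z := by linarith
  have key := intbound q C x hq hC hx (fun p => |p.2 ^ 2 * (deriv (fun s => laguerreHeatKernel a s p.1 z) (p.2 ^ 2) -
              deriv (fun s => hermiteHeatKernel s p.1 z) (p.2 ^ 2))| ^ q / p.2 ^ 2) ?_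
  · have hnn : 0 ≤ ∫ p in {p : ℝ × ℝ | 0 < p.1 ∧ 0 < p.2 ∧ |p.1 - x| < p.2},
          |p.2 ^ 2 * (deriv (fun s => laguerreHeatKernel a s p.1 z) (p.2 ^ 2) -
              deriv (fun s => hermiteHeatKernel s p.1 z) (p.2 ^ 2))| ^ q / p.2 ^ 2 :=
      integral_nonneg fun p => by simp only [Pi.zero_apply]; positivity
    have h1 := Real.rpow_le_rpow hnn key (show 0 ≤ 1 / q by positivity)
    refine h1.trans ?_
    rw [Real.mul_rpow (by norm_num) (by positivity), ← Real.rpow_mul (by positivity),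
      mul_one_div_cancel (by linarith), Real.rpow_one]
    have h4 : (4:ℝ) ^ (1/q) ≤ 4 := by
      have : (4:ℝ) ^ (1/q) ≤ 4 ^ (1:ℝ) := Real.rpow_le_rpow_of_exponent_le (by norm_num) (by
        rw [div_le_one (by linarith)]; linarith)
      simpa using this
    calc _ ≤ 4 * (2 * C / x) := by gcongr
      _ ≤ 16 * C / z := by
        rw [← mul_div_assoc, div_le_div_iff₀ hx hz]
        nlinarith
      _ ≤ _ := by
        have : 0 ≤ √(z / |z - x|) := Real.sqrt_nonneg _
        have h5 : 0 < 16 * C / z := by positivity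
        nlinarith
  · intro p hy ht hyt
    obtain ⟨b1, b2⟩ := hb p.2 p.1 z ht hy hz
    rw [abs_of_nonneg (by positivity)]
    split_ifs with h
    · have hyx : x / 2 < p.1 := by linarith [(abs_lt.1 hyt).1]
      have hyz : x ^ 2 / 4 ≤ p.1 * z := by nlinarith
      have b3 : C * p.2 / (p.1 * z) ≤ 4 * C * p.2 / x ^ 2 := by
        calc _ ≤ C * p.2 / (x ^ 2 / 4) := by gcongr
          _ = _ := by field_simp
      have := b2.trans b3
      gcongr
    · gcongr
end

section
/- Let α > -1/2 and 1 < p < ∞. For every f ∈ span{φ_n^α : n ∈ ℕ} and h ∈ span{φ_n^α : n ∈ ℕ}, one has ∫_0^∞ f(x) h(x) dx = 8 ∫_0^∞ ∫_{Γ₊(x)} [s ∂/∂s W_s^α(f)(y)]|_{s=t²} · [s ∂/∂s W_s^α(h)(y)]|_{s=t²} dt dy/(t |J_t(y)|) dx, where Γ₊(x) = {(y,t) ∈ (0,∞)² : |x - y| < t} and J_t(y) = {x ∈ (0,∞) : |x - y| < t}. -/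
open MeasureTheory Real

/-- The generalized Laguerre polynomial `L_n^a(x)`. -/
noncomputable def laguerrePoly (a : ℝ) (n : ℕ) (x : ℝ) : ℝ :=
  ∑ k ∈ Finset.range (n + 1),
    (-1 : ℝ) ^ k * (Real.Gamma ((n : ℝ) + a + 1) /
      (Real.Gamma ((k : ℝ) + a + 1) * (Nat.factorial (n - k) : ℝ) * (Nat.factorial k : ℝ))) *
      x ^ k

/-- The Laguerre function `φ_n^a(x)`. -/
noncomputable def laguerreFun (a : ℝ) (n : ℕ) (x : ℝ) : ℝ :=
  (2 * (Nat.factorial n : ℝ) / Real.Gamma ((n : ℝ) + 1 + a)) ^ ((1 : ℝ) / 2) *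
    Real.exp (-x ^ 2 / 2) * x ^ (a + 1 / 2) * laguerrePoly a n (x ^ 2)

/-- The Laguerre heat semigroup `W_s^a(f)`. -/
noncomputable def laguerreHeat (a : ℝ) (f : ℝ → ℝ) (s y : ℝ) : ℝ :=
  ∑' n : ℕ, (∫ x in Set.Ioi (0 : ℝ), laguerreFun a n x * f x) *
    Real.exp (-(2 * (n : ℝ) + a + 1) * s) * laguerreFun a n y


noncomputable def lagCoeff (a : ℝ) (n k : ℕ) : ℝ :=
  (-1 : ℝ) ^ k * (Real.Gamma ((n : ℝ) + a + 1) /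
      (Real.Gamma ((k : ℝ) + a + 1) * (Nat.factorial (n - k) : ℝ) * (Nat.factorial k : ℝ)))

lemma gamma_add_nat (z : ℝ) (hz : 0 < z) (j : ℕ) :
    Real.Gamma (z + j) = (ascPochhammer ℝ j).eval z * Real.Gamma z := by
  induction j with
  | zero => simp
  | succ j ih =>
    rw [ascPochhammer_succ_eval]
    push_cast
    rw [← add_assoc, Real.Gamma_add_one (by positivity), ih]
    ring

lemma fd_poch (z : ℝ) (n j : ℕ) (hj : j ≤ n) :
    ∑ k ∈ Finset.range (n + 1), ((-1 : ℝ) ^ (n - k) * (n.choose k : ℝ)) *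
      (ascPochhammer ℝ j).eval (z + k) = if j = n then (n.factorial : ℝ) else 0 := by
  have h := fwdDiff_iter_eq_sum_shift (1 : ℝ) (fun x => (ascPochhammer ℝ j).eval x) n z
  have e : ∑ k ∈ Finset.range (n + 1), ((-1 : ℝ) ^ (n - k) * (n.choose k : ℝ)) *
      (ascPochhammer ℝ j).eval (z + k) = (fwdDiff (1:ℝ))^[n] (fun x => (ascPochhammer ℝ j).eval x) z := by
    rw [h]
    refine Finset.sum_congr rfl fun k _ => ?_
    simp [zsmul_eq_mul]
  rw [e]
  split_ifs with hjn
  · subst hjn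
    have := Polynomial.fwdDiff_iter_degree_eq_factorial (ascPochhammer ℝ j)
    rw [ascPochhammer_natDegree, (monic_ascPochhammer ℝ j).leadingCoeff] at this
    have := congrFun this z
    simpa using this
  · have := Polynomial.fwdDiff_iter_eq_zero_of_degree_lt (P := ascPochhammer ℝ j) (n := n)
      (by rw [ascPochhammer_natDegree]; omega)
    exact congrFun this z

lemma lag_moment (a : ℝ) (ha : -1 < a) (n j : ℕ) (hj : j ≤ n) :
    ∑ k ∈ Finset.range (n + 1), lagCoeff a n k * Real.Gamma (a + 1 + (k + j)) =
      if j = n then (-1 : ℝ) ^ n * Real.Gamma (n + a + 1) else 0 := by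
  have key : ∀ k ∈ Finset.range (n + 1), lagCoeff a n k * Real.Gamma (a + 1 + (k + j)) =
      ((-1 : ℝ) ^ n * Real.Gamma (n + a + 1) / n.factorial) *
      (((-1 : ℝ) ^ (n - k) * (n.choose k : ℝ)) * (ascPochhammer ℝ j).eval (a + 1 + k)) := by
    intro k hk
    have hk' : k ≤ n := by simpa [Nat.lt_succ_iff] using hk
    have hpos : 0 < a + 1 + (k : ℝ) := by
      have : (0 : ℝ) ≤ k := Nat.cast_nonneg k
      linarith
    have hG := Real.Gamma_pos_of_pos hpos
    rw [← add_assoc, gamma_add_nat _ hpos, lagCoeff, Nat.cast_choose ℝ hk',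
      show (k : ℝ) + a + 1 = a + 1 + k by ring]
    have hs : (-1 : ℝ) ^ n * (-1) ^ (n - k) = (-1) ^ k := by
      obtain ⟨m, rfl⟩ := Nat.exists_eq_add_of_le hk'
      rw [Nat.add_sub_cancel_left, pow_add, mul_assoc, ← mul_pow]
      simp
    rw [← hs]
    have h1 : (n.factorial : ℝ) ≠ 0 := by positivity
    have h2 : (k.factorial : ℝ) ≠ 0 := by positivity
    have h3 : ((n - k).factorial : ℝ) ≠ 0 := by positivity
    field_simp
  rw [Finset.sum_congr rfl key, ← Finset.mul_sum, fd_poch _ _ _ hj]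
  split_ifs with h
  · have h1 : (n.factorial : ℝ) ≠ 0 := by positivity
    field_simp
  · simp

noncomputable def lagNorm (a : ℝ) (n : ℕ) : ℝ :=
  (2 * (Nat.factorial n : ℝ) / Real.Gamma ((n : ℝ) + 1 + a)) ^ ((1 : ℝ) / 2)

lemma lag_mul_eq (a : ℝ) (n m : ℕ) (x : ℝ) (hx : 0 < x) :
    laguerreFun a n x * laguerreFun a m x = ∑ j ∈ Finset.range (m + 1),
      ∑ k ∈ Finset.range (n + 1), (lagNorm a n * lagNorm a m * (lagCoeff a m j * lagCoeff a n k)) *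
        (x ^ (2 * a + 1 + 2 * (k + j)) * Real.exp (-x ^ (2 : ℝ))) := by
  have e1 : ∀ j k : ℕ, x ^ (2 * a + 1 + 2 * ((k : ℝ) + j)) * Real.exp (-x ^ (2 : ℝ)) =
      (Real.exp (-x ^ 2 / 2) * x ^ (a + 1 / 2)) ^ 2 * ((x ^ 2) ^ j * (x ^ 2) ^ k) := by
    intro j k
    have : 2 * a + 1 + 2 * ((k : ℝ) + j) = (a + 1 / 2) + (a + 1/2) + ((2 * j + 2 * k : ℕ) : ℝ) := by
      push_cast; ring
    rw [this, Real.rpow_add hx, Real.rpow_add hx, Real.rpow_natCast, Real.rpow_two, mul_pow,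
      ← Real.exp_nat_mul, pow_add, pow_mul, pow_mul]
    rw [show ((2 : ℕ) : ℝ) * (-x ^ 2 / 2) = -x ^ 2 by push_cast; ring]
    ring
  simp_rw [e1]
  have e2 : ∀ n, laguerrePoly a n (x ^ 2) = ∑ k ∈ Finset.range (n + 1), lagCoeff a n k * (x ^ 2) ^ k :=
    fun n => rfl
  unfold laguerreFun
  rw [e2, e2]
  change lagNorm a n * _ * _ * _ * (lagNorm a m * _ * _ * _) = _
  calc _ = (lagNorm a n * lagNorm a m * (Real.exp (-x ^ 2 / 2) * x ^ (a + 1 / 2)) ^ 2) *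
        ((∑ j ∈ Finset.range (m + 1), lagCoeff a m j * (x ^ 2) ^ j) *
          (∑ k ∈ Finset.range (n + 1), lagCoeff a n k * (x ^ 2) ^ k)) := by ring
    _ = _ := by
      rw [Finset.sum_mul_sum, Finset.mul_sum]
      refine Finset.sum_congr rfl fun j _ => ?_
      rw [Finset.mul_sum]
      refine Finset.sum_congr rfl fun k _ => ?_
      ring

lemma lag_int_term (a : ℝ) (ha : -1 < a) (j k : ℕ) :
    IntegrableOn (fun x : ℝ => x ^ (2 * a + 1 + 2 * ((k : ℝ) + j)) * Real.exp (-x ^ (2 : ℝ)))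
      (Set.Ioi 0) := by
  have h1 : (0 : ℝ) ≤ k := Nat.cast_nonneg k
  have h2 : (0 : ℝ) ≤ j := Nat.cast_nonneg j
  exact integrableOn_rpow_mul_exp_neg_rpow (by linarith) (by norm_num)

lemma lag_integral_term (a : ℝ) (ha : -1 < a) (j k : ℕ) :
    ∫ x in Set.Ioi (0 : ℝ), (x ^ (2 * a + 1 + 2 * ((k : ℝ) + j)) * Real.exp (-x ^ (2 : ℝ))) =
      1 / 2 * Real.Gamma (a + 1 + (k + j)) := by
  have h1 : (0 : ℝ) ≤ k := Nat.cast_nonneg k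
  have h2 : (0 : ℝ) ≤ j := Nat.cast_nonneg j
  rw [integral_rpow_mul_exp_neg_rpow (by norm_num) (by linarith)]
  congr 2
  ring

lemma lag_integrable (a : ℝ) (ha : -1 < a) (n m : ℕ) :
    IntegrableOn (fun x => laguerreFun a n x * laguerreFun a m x) (Set.Ioi 0) := by
  refine IntegrableOn.congr_fun (f := fun x => ∑ j ∈ Finset.range (m + 1),
      ∑ k ∈ Finset.range (n + 1), (lagNorm a n * lagNorm a m * (lagCoeff a m j * lagCoeff a n k)) *
        (x ^ (2 * a + 1 + 2 * ((k : ℝ) + j)) * Real.exp (-x ^ (2 : ℝ)))) ?_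
    (fun x hx => (lag_mul_eq a n m x hx).symm) measurableSet_Ioi
  refine integrable_finsetSum _ fun j _ => integrable_finsetSum _ fun k _ => ?_
  exact (lag_int_term a ha j k).const_mul _

lemma lag_ortho_le (a : ℝ) (ha : -1 < a) (n m : ℕ) (hmn : m ≤ n) :
    ∫ x in Set.Ioi (0 : ℝ), laguerreFun a n x * laguerreFun a m x = if n = m then 1 else 0 := by
  rw [setIntegral_congr_fun measurableSet_Ioi (fun x hx => lag_mul_eq a n m x hx)]
  have hi : ∀ j k : ℕ, Integrable (fun x : ℝ =>
      (lagNorm a n * lagNorm a m * (lagCoeff a m j * lagCoeff a n k)) *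
        (x ^ (2 * a + 1 + 2 * ((k : ℝ) + j)) * Real.exp (-x ^ (2 : ℝ))))
        (volume.restrict (Set.Ioi 0)) := fun j k => (lag_int_term a ha j k).const_mul _
  rw [integral_finsetSum _ fun j _ => integrable_finsetSum _ fun k _ => hi j k]
  have step : ∀ j ∈ Finset.range (m + 1), ∫ x in Set.Ioi (0 : ℝ),
      ∑ k ∈ Finset.range (n + 1), (lagNorm a n * lagNorm a m * (lagCoeff a m j * lagCoeff a n k)) *
        (x ^ (2 * a + 1 + 2 * ((k : ℝ) + j)) * Real.exp (-x ^ (2 : ℝ))) =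
      (lagNorm a n * lagNorm a m * lagCoeff a m j / 2) *
        (if j = n then (-1 : ℝ) ^ n * Real.Gamma (n + a + 1) else 0) := by
    intro j hj
    have hj' : j ≤ m := by simpa [Nat.lt_succ_iff] using hj
    rw [integral_finsetSum _ fun k _ => hi j k, ← lag_moment a ha n j (hj'.trans hmn),
      Finset.mul_sum]
    refine Finset.sum_congr rfl fun k _ => ?_
    rw [integral_const_mul, lag_integral_term a ha]
    ring
  rw [Finset.sum_congr rfl step]
  split_ifs with h
  · subst h
    have hpos : 0 < (n : ℝ) + a + 1 := by
      have : (0 : ℝ) ≤ n := Nat.cast_nonneg n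
      linarith
    have hG := Real.Gamma_pos_of_pos hpos
    rw [Finset.sum_eq_single n (fun b _ hb => by simp [hb]) (by simp)]
    have hN : lagNorm a n * lagNorm a n = 2 * n.factorial / Real.Gamma (n + a + 1) := by
      unfold lagNorm
      rw [show (n : ℝ) + 1 + a = n + a + 1 by ring, ← Real.sqrt_eq_rpow, Real.mul_self_sqrt]
      positivity
    rw [hN, lagCoeff, if_pos rfl]
    have hs : (-1 : ℝ) ^ n * (-1) ^ n = 1 := by rw [← mul_pow]; simp
    have h1 : (n.factorial : ℝ) ≠ 0 := by positivity
    simp only [Nat.sub_self, Nat.factorial_zero, Nat.cast_one]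
    field_simp
    linear_combination hs
  · refine Finset.sum_eq_zero fun j hj => ?_
    have hj' : j ≤ m := by simpa [Nat.lt_succ_iff] using hj
    rw [if_neg (by omega), mul_zero]

lemma lag_ortho (a : ℝ) (ha : -1 < a) (n m : ℕ) :
    ∫ x in Set.Ioi (0 : ℝ), laguerreFun a n x * laguerreFun a m x = if n = m then 1 else 0 := by
  rcases le_total m n with h | h
  · exact lag_ortho_le a ha n m h
  · simp_rw [mul_comm (laguerreFun a n _)]
    rw [lag_ortho_le a ha m n h]
    simp [eq_comm]

lemma J_vol (y t : ℝ) :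
    (volume {u : ℝ | 0 < u ∧ |u - y| < t}).toReal = max (y + t - max 0 (y - t)) 0 := by
  have : {u : ℝ | 0 < u ∧ |u - y| < t} = Set.Ioo (max 0 (y - t)) (y + t) := by
    ext u
    simp only [Set.mem_ofPred_eq, Set.mem_Ioo, abs_lt, max_lt_iff]
    constructor
    · rintro ⟨h1, h2, h3⟩; exact ⟨⟨h1, by linarith⟩, by linarith⟩
    · rintro ⟨⟨h1, h2⟩, h3⟩; exact ⟨h1, by linarith, by linarith⟩
  rw [this, Real.volume_Ioo, ENNReal.toReal_ofReal']

lemma cone_fubini (G : ℝ × ℝ → ℝ)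
    (hG : IntegrableOn G (Set.Ioi (0 : ℝ) ×ˢ Set.Ioi (0 : ℝ))) :
    ∫ x in Set.Ioi (0 : ℝ), ∫ p in {p : ℝ × ℝ | 0 < p.1 ∧ 0 < p.2 ∧ |x - p.1| < p.2},
      G p / (volume {u : ℝ | 0 < u ∧ |u - p.1| < p.2}).toReal =
    ∫ p in Set.Ioi (0 : ℝ) ×ˢ Set.Ioi (0 : ℝ), G p := by
  set Q := Set.Ioi (0 : ℝ) ×ˢ Set.Ioi (0 : ℝ) with hQ
  have hQm : MeasurableSet Q := measurableSet_Ioi.prod measurableSet_Ioi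
  set μ : Measure ℝ := volume.restrict (Set.Ioi 0)
  set ν : Measure (ℝ × ℝ) := volume.restrict Q
  set V : ℝ × ℝ → ℝ := fun p => (volume {u : ℝ | 0 < u ∧ |u - p.1| < p.2}).toReal with hV
  have hVeq : V = fun p => max (p.1 + p.2 - max 0 (p.1 - p.2)) 0 := by
    ext p; exact J_vol p.1 p.2
  have hVm : Measurable V := by rw [hVeq]; fun_prop
  have hVpos : ∀ p ∈ Q, 0 < V p := by
    rintro p ⟨h1, h2⟩
    simp only [Set.mem_Ioi] at h1 h2
    rw [hVeq]
    refine lt_max_of_lt_left ?_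
    have : max 0 (p.1 - p.2) < p.1 + p.2 := max_lt (by linarith) (by linarith)
    linarith
  set S : Set (ℝ × (ℝ × ℝ)) := {z | |z.1 - z.2.1| < z.2.2} with hS
  have hSm : MeasurableSet S := measurableSet_lt (by fun_prop) (by fun_prop)
  set F : ℝ → ℝ × ℝ → ℝ := fun x p => S.indicator (fun z => G z.2 / V z.2) (x, p) with hF
  have hsec : ∀ p, MeasurableSet {x : ℝ | |x - p.1| < (p : ℝ × ℝ).2} := fun p =>
    measurableSet_lt (by fun_prop) (by fun_prop)
  have hFx : ∀ p x, F x p = {x : ℝ | |x - p.1| < p.2}.indicator (fun _ => G p / V p) x := by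
    intro p x; rfl
  have hmeas : ∀ p, μ.real {x : ℝ | |x - p.1| < (p : ℝ × ℝ).2} = V p := by
    intro p
    rw [Measure.real, Measure.restrict_apply (hsec p), hV]
    congr 2
    ext u; simp [and_comm]
  have hfin : ∀ p, μ {x : ℝ | |x - p.1| < (p : ℝ × ℝ).2} ≠ ⊤ := by
    intro p
    refine ne_top_of_le_ne_top ?_ (Measure.restrict_apply_le _ _)
    have : {x : ℝ | |x - p.1| < p.2} = Metric.ball p.1 p.2 := by
      ext x; simp [Real.dist_eq]
    rw [this]
    exact measure_ball_lt_top.ne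
  have hasm : AEStronglyMeasurable (Function.uncurry F) (μ.prod ν) := by
    have h1 : AEStronglyMeasurable (fun z : ℝ × (ℝ × ℝ) => G z.2 / V z.2) (μ.prod ν) := by
      have : AEStronglyMeasurable (fun p => G p / V p) ν :=
        hG.aestronglyMeasurable.div₀ hVm.aestronglyMeasurable
      exact this.comp_snd
    exact h1.indicator hSm
  have hnorm : ∀ p, ∫ x, ‖F x p‖ ∂μ = V p * ‖G p / V p‖ := by
    intro p
    simp_rw [hFx p, norm_indicator_eq_indicator_norm]
    rw [integral_indicator_const _ (hsec p), hmeas p, smul_eq_mul]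
  have hval : ∀ p, ∫ x, F x p ∂μ = V p * (G p / V p) := by
    intro p
    simp_rw [hFx p]
    rw [integral_indicator_const _ (hsec p), hmeas p, smul_eq_mul]
  have hint : Integrable (Function.uncurry F) (μ.prod ν) := by
    rw [integrable_prod_iff' hasm]
    constructor
    · refine Filter.Eventually.of_forall fun p => ?_
      change Integrable (fun x => F x p) μ
      simp_rw [hFx p]
      exact (integrable_indicator_iff (hsec p)).2 (integrableOn_const (hfin p))
    · change Integrable (fun p => ∫ x, ‖F x p‖ ∂μ) ν
      simp_rw [hnorm]
      refine hG.norm.congr ?_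
      filter_upwards [ae_restrict_mem hQm] with p hp
      have := hVpos p hp
      rw [norm_div, Real.norm_of_nonneg this.le]
      field_simp
  have hL : ∀ x, ∫ p in {p : ℝ × ℝ | 0 < p.1 ∧ 0 < p.2 ∧ |x - p.1| < p.2}, G p / V p =
      ∫ p, F x p ∂ν := by
    intro x
    have hm : MeasurableSet {p : ℝ × ℝ | |x - p.1| < p.2} :=
      measurableSet_lt (by fun_prop) (by fun_prop)
    have : ∀ p, F x p = {p : ℝ × ℝ | |x - p.1| < p.2}.indicator (fun p => G p / V p) p :=
      fun p => rfl
    simp_rw [this]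
    rw [integral_indicator hm, Measure.restrict_restrict hm]
    congr 2
    ext p
    simp [hQ]
    tauto
  refine (integral_congr_ae (Filter.Eventually.of_forall hL)).trans ?_
  rw [integral_integral_swap hint]
  simp_rw [hval]
  refine setIntegral_congr_fun hQm fun p hp => ?_
  have := hVpos p hp
  field_simp

lemma t_integrable (b : ℝ) (hb : 0 < b) :
    IntegrableOn (fun t : ℝ => t ^ 3 * Real.exp (-b * t ^ 2)) (Set.Ioi 0) := by
  have := integrableOn_rpow_mul_exp_neg_mul_rpow (p := 2) (s := 3) (b := b) (by norm_num) (by norm_num) hb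
  refine this.congr_fun (fun t _ => ?_) measurableSet_Ioi
  simp only [Real.rpow_two]
  norm_cast

lemma t_integral (b : ℝ) (hb : 0 < b) :
    ∫ t in Set.Ioi (0 : ℝ), t ^ 3 * Real.exp (-b * t ^ 2) = 1 / (2 * b ^ 2) := by
  have := integral_rpow_mul_exp_neg_mul_rpow (p := 2) (q := 3) (b := b) (by norm_num) (by norm_num) hb
  have h2 : ∫ t in Set.Ioi (0 : ℝ), t ^ 3 * Real.exp (-b * t ^ 2) =
      ∫ t in Set.Ioi (0 : ℝ), t ^ (3 : ℝ) * Real.exp (-b * t ^ (2 : ℝ)) := by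
    refine setIntegral_congr_fun measurableSet_Ioi (fun t _ => ?_)
    simp only [Real.rpow_two]
    norm_cast
  rw [h2, this, show (-(3 + 1) / 2 : ℝ) = -(2 : ℕ) by norm_num, Real.rpow_neg hb.le,
    Real.rpow_natCast, show ((3 + 1) / 2 : ℝ) = 2 by norm_num, Real.Gamma_two]
  field_simp

lemma heat_eq (a : ℝ) (ha : -1 < a) (c : ℕ →₀ ℝ) (s y : ℝ) :
    laguerreHeat a (fun x => ∑ n ∈ c.support, c n * laguerreFun a n x) s y =
      ∑ n ∈ c.support, c n * Real.exp (-(2 * (n : ℝ) + a + 1) * s) * laguerreFun a n y := by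
  have hc : ∀ n, ∫ x in Set.Ioi (0 : ℝ), laguerreFun a n x *
      ∑ m ∈ c.support, c m * laguerreFun a m x = c n := by
    intro n
    have e : ∀ x, laguerreFun a n x * ∑ m ∈ c.support, c m * laguerreFun a m x =
        ∑ m ∈ c.support, c m * (laguerreFun a n x * laguerreFun a m x) := fun x => by
      rw [Finset.mul_sum]
      exact Finset.sum_congr rfl fun m _ => by ring
    simp_rw [e]
    rw [integral_finsetSum _ fun m _ => (lag_integrable a ha n m).const_mul _]
    simp_rw [integral_const_mul, lag_ortho a ha]
    simp
    exact fun h => h.symm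
  unfold laguerreHeat
  simp_rw [hc]
  refine tsum_eq_sum fun n hn => ?_
  simp [Finsupp.notMem_support_iff.1 hn]

lemma heat_deriv (a : ℝ) (ha : -1 < a) (c : ℕ →₀ ℝ) (s y : ℝ) :
    deriv (fun s => laguerreHeat a (fun x => ∑ n ∈ c.support, c n * laguerreFun a n x) s y) s =
      ∑ n ∈ c.support, -(c n * (2 * (n : ℝ) + a + 1) *
        Real.exp (-(2 * (n : ℝ) + a + 1) * s) * laguerreFun a n y) := by
  simp_rw [heat_eq a ha]
  refine HasDerivAt.deriv (HasDerivAt.fun_sum fun n _ => ?_)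
  have h1 : HasDerivAt (fun s : ℝ => -(2 * (n : ℝ) + a + 1) * s) (-(2 * (n : ℝ) + a + 1)) s := by
    simpa using (hasDerivAt_id s).const_mul (-(2 * (n : ℝ) + a + 1))
  have h2 := ((h1.exp).const_mul (c n)).mul_const (laguerreFun a n y)
  exact h2.congr_deriv (by ring)

lemma span_repr (a : ℝ) (f : ℝ → ℝ) (hf : f ∈ Submodule.span ℝ (Set.range (laguerreFun a))) :
    ∃ c : ℕ →₀ ℝ, f = fun x => ∑ n ∈ c.support, c n * laguerreFun a n x := by
  obtain ⟨c, hc⟩ := (Finsupp.mem_span_range_iff_exists_finsupp).1 hf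
  refine ⟨c, ?_⟩
  rw [← hc]
  ext x
  simp [Finsupp.sum, Finset.sum_apply]

theorem stmt19 (a : ℝ) (ha : -(1 / 2) < a) (p : ℝ) (hp₁ : 1 < p)
    (f h : ℝ → ℝ)
    (hf : f ∈ Submodule.span ℝ (Set.range (laguerreFun a)))
    (hh : h ∈ Submodule.span ℝ (Set.range (laguerreFun a))) :
    ∫ x in Set.Ioi (0 : ℝ), f x * h x =
      8 * ∫ x in Set.Ioi (0 : ℝ),
        ∫ p in {p : ℝ × ℝ | 0 < p.1 ∧ 0 < p.2 ∧ |x - p.1| < p.2},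
          (p.2 ^ 2 * deriv (fun s => laguerreHeat a f s p.1) (p.2 ^ 2)) *
            (p.2 ^ 2 * deriv (fun s => laguerreHeat a h s p.1) (p.2 ^ 2)) /
            (p.2 * (volume {u : ℝ | 0 < u ∧ |u - p.1| < p.2}).toReal) := by
  have ha' : -1 < a := by linarith
  have hl : ∀ n : ℕ, 0 < 2 * (n : ℝ) + a + 1 := fun n => by
    have : (0 : ℝ) ≤ n := Nat.cast_nonneg n
    linarith
  obtain ⟨c, rfl⟩ := span_repr a f hf
  obtain ⟨d, rfl⟩ := span_repr a h hh
  set G : ℝ × ℝ → ℝ := fun p => ∑ n ∈ c.support, ∑ m ∈ d.support,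
    (c n * d m * ((2 * (n : ℝ) + a + 1) * (2 * (m : ℝ) + a + 1))) *
      ((laguerreFun a n p.1 * laguerreFun a m p.1) *
        (p.2 ^ 3 * Real.exp (-((2 * (n : ℝ) + a + 1) + (2 * (m : ℝ) + a + 1)) * p.2 ^ 2))) with hGdef
  have hterm : ∀ n m : ℕ, IntegrableOn (fun p : ℝ × ℝ =>
    (c n * d m * ((2 * (n : ℝ) + a + 1) * (2 * (m : ℝ) + a + 1))) *
      ((laguerreFun a n p.1 * laguerreFun a m p.1) *
        (p.2 ^ 3 * Real.exp (-((2 * (n : ℝ) + a + 1) + (2 * (m : ℝ) + a + 1)) * p.2 ^ 2))))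
      (Set.Ioi (0 : ℝ) ×ˢ Set.Ioi (0 : ℝ)) := by
    intro n m
    have := Integrable.mul_prod (lag_integrable a ha' n m)
      (t_integrable ((2 * (n : ℝ) + a + 1) + (2 * (m : ℝ) + a + 1)) (add_pos (hl n) (hl m)))
    rw [Measure.prod_restrict] at this
    exact this.const_mul _
  have hG : IntegrableOn G (Set.Ioi (0 : ℝ) ×ˢ Set.Ioi (0 : ℝ)) :=
    integrable_finsetSum _ fun n _ => integrable_finsetSum _ fun m _ => hterm n m
  have hpt : ∀ p : ℝ × ℝ,
      (p.2 ^ 2 * deriv (fun s => laguerreHeat a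
          (fun x => ∑ n ∈ c.support, c n * laguerreFun a n x) s p.1) (p.2 ^ 2)) *
        (p.2 ^ 2 * deriv (fun s => laguerreHeat a
          (fun x => ∑ n ∈ d.support, d n * laguerreFun a n x) s p.1) (p.2 ^ 2)) /
        (p.2 * (volume {u : ℝ | 0 < u ∧ |u - p.1| < p.2}).toReal) =
      G p / (volume {u : ℝ | 0 < u ∧ |u - p.1| < p.2}).toReal := by
    intro p
    rw [heat_deriv a ha', heat_deriv a ha', ← div_div]
    congr 1
    rw [mul_mul_mul_comm, Finset.sum_mul_sum, Finset.mul_sum, Finset.sum_div]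
    refine Finset.sum_congr rfl fun n _ => ?_
    rw [Finset.mul_sum, Finset.sum_div]
    refine Finset.sum_congr rfl fun m _ => ?_
    have hexp : Real.exp (-((2 * (n : ℝ) + a + 1) + (2 * (m : ℝ) + a + 1)) * p.2 ^ 2) =
        Real.exp (-(2 * (n : ℝ) + a + 1) * p.2 ^ 2) *
          Real.exp (-(2 * (m : ℝ) + a + 1) * p.2 ^ 2) := by
      rw [← Real.exp_add]; congr 1; ring
    rw [hexp]
    generalize Real.exp (-(2 * (n : ℝ) + a + 1) * p.2 ^ 2) = E₁
    generalize Real.exp (-(2 * (m : ℝ) + a + 1) * p.2 ^ 2) = E₂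
    by_cases ht : p.2 = 0
    · simp [ht]
    · field_simp
  simp_rw [hpt]
  rw [cone_fubini G hG, hGdef]
  rw [integral_finsetSum _ fun n _ => integrable_finsetSum _ fun m _ => hterm n m, Finset.mul_sum]
  simp_rw [Finset.sum_mul_sum]
  have hterm2 : ∀ n m : ℕ, Integrable (fun x => c n * laguerreFun a n x * (d m * laguerreFun a m x))
      (volume.restrict (Set.Ioi (0 : ℝ))) := by
    intro n m
    refine ((lag_integrable a ha' n m).const_mul (c n * d m)).congr ?_
    exact Filter.Eventually.of_forall fun x => by ring
  rw [integral_finsetSum _ fun n _ => integrable_finsetSum _ fun m _ => hterm2 n m]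
  refine Finset.sum_congr rfl fun n _ => ?_
  rw [integral_finsetSum _ fun m _ => hterm2 n m, integral_finsetSum _ fun m _ => hterm n m,
    Finset.mul_sum]
  refine Finset.sum_congr rfl fun m _ => ?_
  have e1 : ∀ x, c n * laguerreFun a n x * (d m * laguerreFun a m x) =
      c n * d m * (laguerreFun a n x * laguerreFun a m x) := fun x => by ring
  simp_rw [e1]
  rw [integral_const_mul, integral_const_mul, Measure.volume_eq_prod,
    setIntegral_prod_mul (fun y => laguerreFun a n y * laguerreFun a m y)
      (fun t => t ^ 3 * Real.exp (-((2 * (n : ℝ) + a + 1) + (2 * (m : ℝ) + a + 1)) * t ^ 2)),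
    lag_ortho a ha', t_integral _ (add_pos (hl n) (hl m))]
  split_ifs with hnm
  · subst hnm
    have := (hl n).ne'
    field_simp
    ring
  · simp
end
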